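/- Let b̃ : ℝ^n → ℝ^n and σ̃ : ℝ^n → ℝ^{n×m} be bounded continuous with σ̃(x)σ̃(x)^⊤ positive definite for every x ∈ ℝ^n, and let f : ℝ^n → ℝ be bounded and uniformly continuous. Then there exists a bounded continuous viscosity solution u of ∂_t u − L̃(D²u, Du, x) = 0 on O with u(·,0) = f, where L̃(M,p,x) := (1/2)·Tr(σ̃(x)σ̃(x)^⊤ M) + b̃(x)·p. -/

import Mathlib

open scoped RealInnerProductSpace Matrix
open Set

noncomputable section

abbrev Evec (n : ℕ) := EuclideanSpace ℝ (Fin n)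

/-- The quadratic form `v ↦ vᵀ X v` associated to an `n × n` real matrix. -/
def quadForm {n : ℕ} (X : Matrix (Fin n) (Fin n) ℝ) (v : Evec n) : ℝ :=
  ∑ i, ∑ j, v i * X i j * v j

/-- Frobenius norm of a real matrix. -/
def frobNorm {n m : ℕ} (A : Matrix (Fin n) (Fin m) ℝ) : ℝ :=
  Real.sqrt (∑ i, ∑ j, (A i j) ^ 2)

/-- The operator `L(M, p, x) = (1/2) Tr(σ(x) σ(x)ᵀ M) + b(x) · p`. -/
def opL {n m : ℕ} (b : Evec n → Evec n) (σ : Evec n → Matrix (Fin n) (Fin m) ℝ)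
    (X : Matrix (Fin n) (Fin n) ℝ) (p x : Evec n) : ℝ :=
  (1 / 2) * Matrix.trace (σ x * (σ x)ᵀ * X) + ⟪b x, p⟫

/-- `(a, p, X)` belongs to the parabolic superjet `P^{2,+} w (x,t)` relative to the
domain `U × (0,T)`. -/
def InSuperJet {n : ℕ} (T : ℝ) (U : Set (Evec n)) (w : Evec n → ℝ → ℝ)
    (x : Evec n) (t a : ℝ) (p : Evec n) (X : Matrix (Fin n) (Fin n) ℝ) : Prop :=
  ∀ η > (0 : ℝ), ∃ δ > (0 : ℝ), ∀ y ∈ U, ∀ s ∈ Set.Ioo (0 : ℝ) T,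
    ‖y - x‖ + |s - t| < δ →
    w y s ≤ w x t + a * (s - t) + ⟪p, y - x⟫ + (1 / 2) * quadForm X (y - x)
      + η * (|s - t| + ‖y - x‖ ^ 2)

/-- `(a, p, X)` belongs to the parabolic subjet `P^{2,-} w (x,t) = -P^{2,+}(-w)(x,t)`. -/
def InSubJet {n : ℕ} (T : ℝ) (U : Set (Evec n)) (w : Evec n → ℝ → ℝ)
    (x : Evec n) (t a : ℝ) (p : Evec n) (X : Matrix (Fin n) (Fin n) ℝ) : Prop :=
  InSuperJet T U (fun y s => -(w y s)) x t (-a) (-p) (-X)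

/-- Jet inequality of a viscosity subsolution of `∂_t u - L(D²u, Du, x) = 0` on `U × (0,T)`. -/
def SubsolutionPropOn {n m : ℕ} (b : Evec n → Evec n) (σ : Evec n → Matrix (Fin n) (Fin m) ℝ)
    (T : ℝ) (U : Set (Evec n)) (u : Evec n → ℝ → ℝ) : Prop :=
  ∀ x ∈ U, ∀ t ∈ Set.Ioo (0 : ℝ) T, ∀ (a : ℝ) (p : Evec n) (X : Matrix (Fin n) (Fin n) ℝ),
    X.IsSymm → InSuperJet T U u x t a p X → a - opL b σ X p x ≤ 0

/-- Jet inequality of a viscosity supersolution of `∂_t u - L(D²u, Du, x) = 0` on `U × (0,T)`. -/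
def SupersolutionPropOn {n m : ℕ} (b : Evec n → Evec n) (σ : Evec n → Matrix (Fin n) (Fin m) ℝ)
    (T : ℝ) (U : Set (Evec n)) (u : Evec n → ℝ → ℝ) : Prop :=
  ∀ x ∈ U, ∀ t ∈ Set.Ioo (0 : ℝ) T, ∀ (a : ℝ) (p : Evec n) (X : Matrix (Fin n) (Fin n) ℝ),
    X.IsSymm → InSubJet T U u x t a p X → 0 ≤ a - opL b σ X p x

/-- The set `L_{b,σ}` of points around which `(b, σ)` is locally Lipschitz. -/
def Lset {n m : ℕ} (b : Evec n → Evec n) (σ : Evec n → Matrix (Fin n) (Fin m) ℝ) :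
    Set (Evec n) :=
  {x | ∃ U ∈ nhds x, ∃ K ≥ (0 : ℝ), ∀ y ∈ U, ∀ z ∈ U,
    ‖b y - b z‖ + frobNorm (σ y - σ z) ≤ K * ‖y - z‖}

/-- The complement `NL_{b,σ}` of `L_{b,σ}`. -/
def NLset {n m : ℕ} (b : Evec n → Evec n) (σ : Evec n → Matrix (Fin n) (Fin m) ℝ) :
    Set (Evec n) :=
  (Lset b σ)ᶜ

/-- Assumption Z on the coefficients `b`, `σ`. -/
structure AssumptionZ {n m : ℕ} (b : Evec n → Evec n) (σ : Evec n → Matrix (Fin n) (Fin m) ℝ)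
    (Cb Cσ α β : ℝ) : Prop where
  hCb : 0 < Cb
  hCσ : 0 < Cσ
  hα : α ∈ Set.Ioc (0 : ℝ) 1
  hβ : β ∈ Set.Ioc (0 : ℝ) 1
  hb_bdd : ∃ C, ∀ x, ‖b x‖ ≤ C
  hσ_bdd : ∃ C, ∀ x, frobNorm (σ x) ≤ C
  hb_hold : ∀ x y, ‖b x - b y‖ ≤ Cb * ‖x - y‖ ^ α
  hσ_hold : ∀ x y, frobNorm (σ x - σ y) ≤ Cσ * ‖x - y‖ ^ β
  hNL : ∀ x ∈ NLset b σ, b x = 0 ∧ σ x = 0 ∧ ∃ r > (0 : ℝ),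
    ∀ y ∈ Metric.ball x r ∩ Lset b σ, ∀ v : Evec n,
      Cσ⁻¹ * ‖x - y‖ ^ (2 * β) * ‖v‖ ^ 2 ≤ quadForm (σ y * (σ y)ᵀ) v ∧
      quadForm (σ y * (σ y)ᵀ) v ≤ Cσ * ‖x - y‖ ^ (2 * β) * ‖v‖ ^ 2
  hexp : 1 + α - 2 * β > 0
  hβ_half : β > 1 / 2

/-- Assumption P on the approximating coefficients `bε`, `σε`. -/
structure AssumptionP {n m : ℕ} (b : Evec n → Evec n) (σ : Evec n → Matrix (Fin n) (Fin m) ℝ)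
    (bε : ℝ → Evec n → Evec n) (σε : ℝ → Evec n → Matrix (Fin n) (Fin m) ℝ) : Prop where
  hb_cont : Continuous b
  hσ_cont : ∀ i j, Continuous fun x => σ x i j
  hb_bdd : ∃ C, ∀ x, ‖b x‖ ≤ C
  hσ_bdd : ∃ C, ∀ x, frobNorm (σ x) ≤ C
  hbε_cont : ∀ ε > (0 : ℝ), Continuous (bε ε)
  hσε_cont : ∀ ε > (0 : ℝ), ∀ i j, Continuous fun x => σε ε x i j
  hbε_bdd : ∀ ε > (0 : ℝ), ∃ C, ∀ x, ‖bε ε x‖ ≤ C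
  hσε_bdd : ∀ ε > (0 : ℝ), ∃ C, ∀ x, frobNorm (σε ε x) ≤ C
  hposdef : ∀ ε > (0 : ℝ), ∀ x, (σε ε x * (σε ε x)ᵀ).PosDef
  hconv_b : ∀ K : Set (Evec n), IsCompact K → ∀ η > (0 : ℝ), ∃ ε₀ > (0 : ℝ),
    ∀ ε, 0 < ε → ε < ε₀ → ∀ x ∈ K, ‖bε ε x - b x‖ < η
  hconv_σ : ∀ K : Set (Evec n), IsCompact K → ∀ η > (0 : ℝ), ∃ ε₀ > (0 : ℝ),
    ∀ ε, 0 < ε → ε < ε₀ → ∀ x ∈ K, frobNorm (σε ε x - σ x) < η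

/-- The upper relaxed half-limit `u*` of a family `(u^ε)_{ε>0}` on `ℝ^n × [0,T)`. -/
def relaxSup {n : ℕ} (T : ℝ) (u : ℝ → Evec n → ℝ → ℝ) (x : Evec n) (t : ℝ) : ℝ :=
  ⨅ δ : {d : ℝ // 0 < d}, sSup {r : ℝ | ∃ ε, 0 < ε ∧ ε < δ.1 ∧ ∃ y : Evec n, ∃ s : ℝ,
    0 ≤ s ∧ s < T ∧ ‖x - y‖ + |t - s| < δ.1 ∧ u ε y s = r}

/-- The lower relaxed half-limit `u_*` of a family `(u^ε)_{ε>0}` on `ℝ^n × [0,T)`. -/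
def relaxInf {n : ℕ} (T : ℝ) (u : ℝ → Evec n → ℝ → ℝ) (x : Evec n) (t : ℝ) : ℝ :=
  ⨆ δ : {d : ℝ // 0 < d}, sInf {r : ℝ | ∃ ε, 0 < ε ∧ ε < δ.1 ∧ ∃ y : Evec n, ∃ s : ℝ,
    0 ≤ s ∧ s < T ∧ ‖x - y‖ + |t - s| < δ.1 ∧ u ε y s = r}

section FrameAvg

variable {F : Type*} [NormedAddCommGroup F] {m : ℕ}

/-- Average of `G` over the `2m` noises `± B i` given by an orthonormal frame `B`. -/
def frameAvg (B : Fin m → F) (G : F → ℝ) : ℝ :=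
  (2 * (m : ℝ))⁻¹ * ∑ i, (G (B i) + G (-B i))

lemma frameAvg_mono {B : Fin m → F} {G H : F → ℝ} (hG : ∀ i, G (B i) ≤ H (B i))
    (hG' : ∀ i, G (-B i) ≤ H (-B i)) : frameAvg B G ≤ frameAvg B H := by
  unfold frameAvg
  gcongr with i
  · exact hG i
  · exact hG' i

lemma frameAvg_le_frameAvg {B : Fin m → F} {G H : F → ℝ} (hG : ∀ v, G v ≤ H v) :
    frameAvg B G ≤ frameAvg B H := frameAvg_mono (fun _ => hG _) fun _ => hG _

lemma frameAvg_add (B : Fin m → F) (G H : F → ℝ) :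
    frameAvg B (fun v => G v + H v) = frameAvg B G + frameAvg B H := by
  unfold frameAvg
  rw [← mul_add, ← Finset.sum_add_distrib]
  congr 1
  exact Finset.sum_congr rfl fun i _ => by ring

lemma frameAvg_const_mul (B : Fin m → F) (c : ℝ) (G : F → ℝ) :
    frameAvg B (fun v => c * G v) = c * frameAvg B G := by
  unfold frameAvg
  rw [mul_left_comm c, Finset.mul_sum (a := c)]
  congr 1
  exact Finset.sum_congr rfl fun i _ => by ring

lemma frameAvg_neg (B : Fin m → F) (G : F → ℝ) :
    frameAvg B (fun v => -G v) = -frameAvg B G := by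
  simpa using frameAvg_const_mul B (-1) G

lemma frameAvg_const (hm : 0 < m) (B : Fin m → F) (c : ℝ) :
    frameAvg B (fun _ => c) = c := by
  have : (0 : ℝ) < m := by exact_mod_cast hm
  simp only [frameAvg, Finset.sum_const, Finset.card_univ, Fintype.card_fin, nsmul_eq_mul]
  field_simp
  ring

lemma frameAvg_le_of_le (hm : 0 < m) {B : Fin m → F} {G : F → ℝ} {c : ℝ} (h : ∀ v, G v ≤ c) :
    frameAvg B G ≤ c :=
  (frameAvg_le_frameAvg h).trans (frameAvg_const hm B c).le

lemma le_frameAvg_of_le (hm : 0 < m) {B : Fin m → F} {G : F → ℝ} {c : ℝ} (h : ∀ v, c ≤ G v) :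
    c ≤ frameAvg B G :=
  (frameAvg_const hm B c).ge.trans (frameAvg_le_frameAvg h)

end FrameAvg

section Scheme

variable {E F : Type*} [NormedAddCommGroup E] [InnerProductSpace ℝ E]
  [NormedAddCommGroup F] [InnerProductSpace ℝ F] {m : ℕ}

/-- Endpoint of one step of length `h` from `x` with drift `b`, diffusion `S` and noise `v`. -/
def stepPt (m : ℕ) (h : ℝ) (b : E → E) (S : E → F →L[ℝ] E) (x : E) (v : F) : E :=
  x + h • b x + √(h * m) • S x v

/-- One step of the scheme: best average over all orthonormal frames. -/
def schemeStep (m : ℕ) (h : ℝ) (b : E → E) (S : E → F →L[ℝ] E) (g : E → ℝ) (x : E) : ℝ :=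
  ⨆ B : OrthonormalBasis (Fin m) ℝ F, frameAvg B fun v => g (stepPt m h b S x v)

/-- The iterates of the scheme with initial datum `f`. -/
def schemeIter (m : ℕ) (h : ℝ) (b : E → E) (S : E → F →L[ℝ] E) (f : E → ℝ) : ℕ → E → ℝ
  | 0 => f
  | k + 1 => schemeStep m h b S (schemeIter m h b S f k)

variable {h : ℝ} {b : E → E} {S : E → F →L[ℝ] E} {g : E → ℝ} {C : ℝ}

lemma frameAvg_le_schemeStep (hm : 0 < m) (hg : ∀ x, |g x| ≤ C) (x : E)
    (B : OrthonormalBasis (Fin m) ℝ F) :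
    frameAvg B (fun v => g (stepPt m h b S x v)) ≤ schemeStep m h b S g x := by
  refine le_ciSup (f := fun B : OrthonormalBasis (Fin m) ℝ F =>
    frameAvg B fun v => g (stepPt m h b S x v)) ⟨C, ?_⟩ B
  rintro _ ⟨B, rfl⟩
  exact frameAvg_le_of_le hm fun v => (abs_le.1 (hg _)).2

lemma schemeStep_le [Nonempty (OrthonormalBasis (Fin m) ℝ F)] {x : E} {c : ℝ}
    (hc : ∀ B : OrthonormalBasis (Fin m) ℝ F,
      frameAvg B (fun v => g (stepPt m h b S x v)) ≤ c) :
    schemeStep m h b S g x ≤ c := ciSup_le hc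

variable [Nonempty (OrthonormalBasis (Fin m) ℝ F)]

lemma abs_schemeStep_le (hm : 0 < m) (hg : ∀ x, |g x| ≤ C) (x : E) :
    |schemeStep m h b S g x| ≤ C := by
  refine abs_le.2 ⟨?_, schemeStep_le fun B =>
    frameAvg_le_of_le hm fun v => (abs_le.1 (hg _)).2⟩
  obtain ⟨B⟩ := ‹Nonempty (OrthonormalBasis (Fin m) ℝ F)›
  exact (le_frameAvg_of_le hm fun v => (abs_le.1 (hg _)).1).trans
    (frameAvg_le_schemeStep hm hg x B)

variable {f : E → ℝ}

lemma abs_schemeIter_le (hm : 0 < m) (hf : ∀ x, |f x| ≤ C) (k : ℕ) (x : E) :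
    |schemeIter m h b S f k x| ≤ C := by
  induction k generalizing x with
  | zero => exact hf x
  | succ k ih => exact abs_schemeStep_le hm ih x

/-- Coupling principle: frames at `x` may be matched with frames at `y`. -/
lemma schemeStep_sub_le (hm : 0 < m) (hg : ∀ x, |g x| ≤ C) {x y : E} {c : ℝ}
    (H : ∀ B : OrthonormalBasis (Fin m) ℝ F, ∃ R : F ≃ₗᵢ[ℝ] F,
      frameAvg B (fun v => g (stepPt m h b S x v) - g (stepPt m h b S y (R v))) ≤ c) :
    schemeStep m h b S g x - schemeStep m h b S g y ≤ c := by
  rw [sub_le_iff_le_add]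
  refine schemeStep_le fun B => ?_
  obtain ⟨R, hR⟩ := H B
  have h1 := frameAvg_le_schemeStep (h := h) (b := b) (S := S) hm hg y (B.map R)
  have h2 : frameAvg (B.map R) (fun v => g (stepPt m h b S y v)) =
      frameAvg B (fun v => g (stepPt m h b S y (R v))) := by
    simp [frameAvg]
  have h3 := frameAvg_add B (fun v => g (stepPt m h b S x v) - g (stepPt m h b S y (R v)))
    (fun v => g (stepPt m h b S y (R v)))
  simp only [sub_add_cancel] at h3
  linarith

/-- The scheme is nonexpansive for the uniform distance. -/
lemma abs_schemeIter_add_sub_le (hm : 0 < m) (hf : ∀ x, |f x| ≤ C) {j : ℕ} {c : ℝ}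
    (hc : ∀ x, |schemeIter m h b S f j x - f x| ≤ c) (k : ℕ) (x : E) :
    |schemeIter m h b S f (j + k) x - schemeIter m h b S f k x| ≤ c := by
  induction k generalizing x with
  | zero => exact hc x
  | succ k ih =>
    have key : ∀ p q : ℕ, (∀ z, |schemeIter m h b S f p z - schemeIter m h b S f q z| ≤ c) →
        schemeIter m h b S f (p + 1) x - schemeIter m h b S f (q + 1) x ≤ c := by
      intro p q hpq
      rw [sub_le_iff_le_add]
      refine schemeStep_le fun B => ?_
      have h1 := frameAvg_le_schemeStep (h := h) (b := b) (S := S) hm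
        (abs_schemeIter_le (h := h) (b := b) (S := S) hm hf q) x B
      have h2 := frameAvg_mono (B := B)
        (G := fun v => schemeIter m h b S f p (stepPt m h b S x v))
        (H := fun v => c + schemeIter m h b S f q (stepPt m h b S x v))
        (fun i => by linarith [(abs_le.1 (hpq (stepPt m h b S x (B i)))).2])
        (fun i => by linarith [(abs_le.1 (hpq (stepPt m h b S x (-B i)))).2])
      rw [frameAvg_add, frameAvg_const hm] at h2
      exact h2.trans (by gcongr; exact h1)
    refine abs_sub_le_iff.2 ⟨key _ _ ih, key _ _ fun z => ?_⟩
    rw [abs_sub_comm]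
    exact ih z

end Scheme

section Moments

variable {E F : Type*} [NormedAddCommGroup E] [InnerProductSpace ℝ E]
  [NormedAddCommGroup F] [InnerProductSpace ℝ F] {m : ℕ} {h : ℝ}

/-- Exact average of a quadratic polynomial over one step. -/
lemma frameAvg_quadratic (hm : 0 < m) (hh : 0 ≤ h) (B : Fin m → F) (A : E →L[ℝ] E) (p c : E)
    (D : F →L[ℝ] E) :
    frameAvg B (fun v => ⟪p, c + √(h * m) • D v⟫ +
        2⁻¹ * ⟪c + √(h * m) • D v, A (c + √(h * m) • D v)⟫) =
      ⟪p, c⟫ + 2⁻¹ * ⟪c, A c⟫ + h * (2⁻¹ * ∑ i, ⟪D (B i), A (D (B i))⟫) := by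
  have hm' : (0 : ℝ) < m := by exact_mod_cast hm
  have hs : √(h * m) * √(h * m) = h * m := Real.mul_self_sqrt (by positivity)
  have key : ∀ i, (⟪p, c + √(h * m) • D (B i)⟫ +
        2⁻¹ * ⟪c + √(h * m) • D (B i), A (c + √(h * m) • D (B i))⟫) +
      (⟪p, c + √(h * m) • D (-B i)⟫ +
        2⁻¹ * ⟪c + √(h * m) • D (-B i), A (c + √(h * m) • D (-B i))⟫) =
      (2 * ⟪p, c⟫ + ⟪c, A c⟫) + h * m * ⟪D (B i), A (D (B i))⟫ := by
    intro i
    simp only [map_neg, map_add, map_smul, smul_neg, inner_add_left, inner_add_right,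
      inner_neg_left, inner_neg_right, real_inner_smul_left, real_inner_smul_right]
    linear_combination ⟪D (B i), A (D (B i))⟫ * hs
  simp only [frameAvg, key, Finset.sum_add_distrib, Finset.sum_const, Finset.card_univ,
    Fintype.card_fin, nsmul_eq_mul, ← Finset.mul_sum]
  field_simp

lemma frameAvg_norm_sq (hm : 0 < m) (hh : 0 ≤ h) (B : Fin m → F) (c : E) (D : F →L[ℝ] E) :
    frameAvg B (fun v => ‖c + √(h * m) • D v‖ ^ 2) =
      ‖c‖ ^ 2 + h * ∑ i, ‖D (B i)‖ ^ 2 := by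
  have := frameAvg_quadratic hm hh B ((2 : ℝ) • ContinuousLinearMap.id ℝ E) 0 c D
  simpa [← smul_add, real_inner_smul_right, ← Finset.mul_sum, -Real.sqrt_mul,
    -Real.sqrt_mul', -Nat.cast_nonneg] using this

lemma sum_norm_sq_le (B : OrthonormalBasis (Fin m) ℝ F) (D : F →L[ℝ] E) :
    ∑ i, ‖D (B i)‖ ^ 2 ≤ m * ‖D‖ ^ 2 := by
  calc ∑ i, ‖D (B i)‖ ^ 2 ≤ ∑ _i : Fin m, ‖D‖ ^ 2 := by
        gcongr with i
        simpa using D.le_opNorm (B i)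
    _ = m * ‖D‖ ^ 2 := by simp

lemma frameAvg_norm_sq_le (hm : 0 < m) (hh : 0 ≤ h) (B : OrthonormalBasis (Fin m) ℝ F) (c : E)
    (D : F →L[ℝ] E) :
    frameAvg B (fun v => ‖c + √(h * m) • D v‖ ^ 2) ≤ ‖c‖ ^ 2 + h * (m * ‖D‖ ^ 2) := by
  rw [frameAvg_norm_sq hm hh]
  gcongr
  exact sum_norm_sq_le B D

variable {b : E → E} {S : E → F →L[ℝ] E} {Cb Cs : ℝ}

/-- `1 + ‖x - x₀‖²` grows at most exponentially along the scheme. -/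
lemma frameAvg_weight_le (hm : 0 < m) (hh : 0 ≤ h) (hh1 : h ≤ 1) (hb : ∀ x, ‖b x‖ ≤ Cb)
    (hS : ∀ x, ‖S x‖ ≤ Cs) (B : OrthonormalBasis (Fin m) ℝ F) (x₀ x : E) :
    frameAvg B (fun v => 1 + ‖stepPt m h b S x v - x₀‖ ^ 2) ≤
      (1 + (Cb + Cb ^ 2 + m * Cs ^ 2) * h) * (1 + ‖x - x₀‖ ^ 2) := by
  have e : ∀ v, stepPt m h b S x v - x₀ = (x - x₀ + h • b x) + √(h * m) • S x v := by
    intro v; unfold stepPt; abel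
  simp only [e]
  rw [frameAvg_add, frameAvg_const hm]
  have h1 := frameAvg_norm_sq_le hm hh B (x - x₀ + h • b x) (S x)
  have h2 : ‖x - x₀ + h • b x‖ ≤ ‖x - x₀‖ + h * Cb := by
    refine (norm_add_le _ _).trans ?_
    rw [norm_smul, Real.norm_of_nonneg hh]
    gcongr
    exact hb x
  have hCb : 0 ≤ Cb := (norm_nonneg _).trans (hb x)
  have h3 : ‖x - x₀ + h • b x‖ ^ 2 ≤ (‖x - x₀‖ + h * Cb) ^ 2 := by gcongr
  have h4 : ‖S x‖ ^ 2 ≤ Cs ^ 2 := by gcongr; exact hS x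
  have h5 : h * (m * ‖S x‖ ^ 2) ≤ h * (m * Cs ^ 2) := by gcongr
  set r := ‖x - x₀‖
  have hr : 0 ≤ r := norm_nonneg _
  have h6 : h * Cb * (2 * r) ≤ h * Cb * (1 + r ^ 2) :=
    mul_le_mul_of_nonneg_left (by nlinarith [sq_nonneg (r - 1)]) (by positivity)
  have h7 : h * (h * Cb ^ 2) ≤ h * (1 * Cb ^ 2) := by gcongr
  have h8 : 0 ≤ h * (Cb ^ 2 + m * Cs ^ 2) * r ^ 2 := by positivity
  nlinarith

/-- Synchronous coupling estimate for Lipschitz coefficients. -/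
lemma frameAvg_sync_le (hm : 0 < m) (hh : 0 ≤ h) (hh1 : h ≤ 1) {L : ℝ} {x y : E}
    (hb : ‖b x - b y‖ ≤ L * ‖x - y‖) (hS : ‖S x - S y‖ ≤ L * ‖x - y‖)
    (B : OrthonormalBasis (Fin m) ℝ F) :
    frameAvg B (fun v => ‖stepPt m h b S x v - stepPt m h b S y v‖ ^ 2) ≤
      (1 + (2 * L + L ^ 2 + m * L ^ 2) * h) * ‖x - y‖ ^ 2 := by
  have e : ∀ v, stepPt m h b S x v - stepPt m h b S y v =
      (x - y + h • (b x - b y)) + √(h * m) • (S x - S y) v := by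
    intro v
    simp only [stepPt, sub_apply, smul_sub]
    abel
  simp only [e]
  have h1 := frameAvg_norm_sq_le hm hh B (x - y + h • (b x - b y)) (S x - S y)
  have h2 : ‖x - y + h • (b x - b y)‖ ≤ ‖x - y‖ + h * (L * ‖x - y‖) := by
    refine (norm_add_le _ _).trans ?_
    rw [norm_smul, Real.norm_of_nonneg hh]
    gcongr
  have h3 : ‖x - y + h • (b x - b y)‖ ^ 2 ≤ (‖x - y‖ + h * (L * ‖x - y‖)) ^ 2 := by gcongr
  have h4 : ‖S x - S y‖ ^ 2 ≤ (L * ‖x - y‖) ^ 2 := by gcongr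
  have h5 : h * (m * ‖S x - S y‖ ^ 2) ≤ h * (m * (L * ‖x - y‖) ^ 2) := by gcongr
  set r := ‖x - y‖
  have h7 : h * (h * (L ^ 2 * r ^ 2)) ≤ h * (1 * (L ^ 2 * r ^ 2)) := by gcongr
  nlinarith

end Moments

section Reflection

variable {E F : Type*} [NormedAddCommGroup E] [InnerProductSpace ℝ E]
  [NormedAddCommGroup F] [InnerProductSpace ℝ F] {m : ℕ} {h : ℝ}

lemma quartic_root_bound {e t : ℝ} (h1 : |e| ≤ 1 / 4) (h4 : t ^ 4 = 1 + e) :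
    t ≤ 1 + e / 4 - 5 / 64 * e ^ 2 := by
  obtain ⟨h1, h2⟩ := abs_le.1 h1
  have hpos : 0 ≤ 1 + e / 4 - 5 / 64 * e ^ 2 := by nlinarith
  refine le_of_pow_le_pow_left₀ (n := 4) (by norm_num) hpos ?_
  rw [h4]
  have key : (1 + e / 4 - 5 / 64 * e ^ 2) ^ 4 - (1 + e) =
      e ^ 2 * (1 / 16 - 11 / 64 * e - 45 / 2048 * e ^ 2 + 75 / 4096 * e ^ 3
        - 125 / 65536 * e ^ 4) + (e / 4 - 5 / 64 * e ^ 2) ^ 4 := by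
    ring
  have he2 : e ^ 2 ≤ 1 / 16 := by nlinarith
  have h3 : -(1 / 64) ≤ e ^ 3 := by nlinarith
  have he4 : e ^ 4 ≤ 1 / 256 := by nlinarith
  have : 0 ≤ e ^ 2 * (1 / 16 - 11 / 64 * e - 45 / 2048 * e ^ 2 + 75 / 4096 * e ^ 3
        - 125 / 65536 * e ^ 4) := mul_nonneg (sq_nonneg e) (by linarith)
  have : 0 ≤ (e / 4 - 5 / 64 * e ^ 2) ^ 4 := by positivity
  linarith

/-- Second order concavity of `√‖·‖`. -/
lemma sqrt_norm_add_sub_le {d w : E} (hd : d ≠ 0) (hw : ‖w‖ ≤ ‖d‖ / 10) :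
    √‖d + w‖ + √‖d - w‖ ≤ √‖d‖ * (2 + ‖w‖ ^ 2 / (2 * ‖d‖ ^ 2)
      - 5 / 8 * (⟪d, w⟫ ^ 2 / ‖d‖ ^ 4)) := by
  have hr : 0 < ‖d‖ := norm_pos_iff.2 hd
  have hin : |⟪d, w⟫| ≤ ‖d‖ * ‖w‖ := abs_real_inner_le_norm d w
  have main : ∀ s : ℝ, |s| = 1 → √‖d + s • w‖ ≤ √‖d‖ *
      (1 + ((2 * s * ⟪d, w⟫ + ‖w‖ ^ 2) / ‖d‖ ^ 2) / 4
        - 5 / 64 * ((2 * s * ⟪d, w⟫ + ‖w‖ ^ 2) / ‖d‖ ^ 2) ^ 2) := by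
    intro s hs
    have hs2 : s ^ 2 = 1 := by rw [← sq_abs, hs]; norm_num
    set e := (2 * s * ⟪d, w⟫ + ‖w‖ ^ 2) / ‖d‖ ^ 2 with he
    have h1 : ‖d + s • w‖ ^ 2 = ‖d‖ ^ 2 * (1 + e) := by
      rw [norm_add_sq_real, real_inner_smul_right, norm_smul, mul_pow, Real.norm_eq_abs, sq_abs,
        hs2, he]
      field_simp
      ring
    have h2 : |e| ≤ 1 / 4 := by
      rw [he, abs_div, abs_of_pos (by positivity : 0 < ‖d‖ ^ 2), div_le_iff₀ (by positivity)]
      refine (abs_add_le _ _).trans ?_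
      rw [abs_mul, abs_mul, hs, abs_of_nonneg (sq_nonneg ‖w‖)]
      norm_num
      nlinarith [norm_nonneg w]
    have h3 : √‖d + s • w‖ / √‖d‖ ≤ 1 + e / 4 - 5 / 64 * e ^ 2 := by
      refine quartic_root_bound h2 ?_
      rw [div_pow, show (4 : ℕ) = 2 * 2 from rfl, pow_mul, pow_mul, Real.sq_sqrt (norm_nonneg _),
        Real.sq_sqrt (norm_nonneg _), h1]
      field_simp
    rwa [div_le_iff₀' (by positivity)] at h3
  have hp := main 1 (by simp)
  have hn := main (-1) (by simp)
  rw [one_smul] at hp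
  rw [neg_one_smul, ← sub_eq_add_neg] at hn
  refine (add_le_add hp hn).trans ?_
  rw [← mul_add]
  refine mul_le_mul_of_nonneg_left ?_ (by positivity)
  have h5 : 0 ≤ 5 / 32 * (‖w‖ ^ 2 / ‖d‖ ^ 2) ^ 2 := by positivity
  refine le_of_sub_nonneg (h5.trans (le_of_eq ?_))
  field_simp
  ring

/-- Average of `√‖·‖` under reflection coupling in the direction of `d`. -/
lemma exists_reflection_frameAvg_le (hm : 0 < m) (hh : 0 ≤ h) {d : E} (hd : d ≠ 0)
    {S₁ S₂ : F →L[ℝ] E} {w : F} {μ l : ℝ} (hw : ‖w‖ = 1) (hSw : S₁ w = (μ / ‖d‖) • d)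
    (hμ : l ≤ μ ^ 2) (hD : 5 * m * ‖S₁ - S₂‖ ^ 2 ≤ l)
    (hstep : √(h * m) * (‖S₁‖ + ‖S₂‖) ≤ ‖d‖ / 10) (B : OrthonormalBasis (Fin m) ℝ F) :
    ∃ R : F ≃ₗᵢ[ℝ] F, frameAvg B (fun v => √‖d + √(h * m) • (S₁ v - S₂ (R v))‖) ≤
      √‖d‖ * (1 - h * l / (16 * ‖d‖ ^ 2)) := by
  have hr : 0 < ‖d‖ := norm_pos_iff.2 hd
  have hm' : (0 : ℝ) < m := by exact_mod_cast hm
  set ρ := √(h * m) with hρ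
  have hρ0 : 0 ≤ ρ := Real.sqrt_nonneg _
  have hρ2 : ρ ^ 2 = h * m := Real.sq_sqrt (by positivity)
  let R : F ≃ₗᵢ[ℝ] F := (ℝ ∙ w)ᗮ.reflection
  have hR : ∀ v, R v = v - (2 * ⟪w, v⟫) • w := by
    intro v
    change (ℝ ∙ w)ᗮ.reflection v = _
    rw [Submodule.reflection_orthogonal_apply, Submodule.reflection_singleton_apply]
    simp [hw, two_smul, two_mul, add_smul]
  refine ⟨R, ?_⟩
  have hz : ∀ v, S₁ v - S₂ (R v) = (S₁ - S₂) (R v) + (2 * ⟪w, v⟫ * (μ / ‖d‖)) • d := by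
    intro v
    rw [mul_smul, ← hSw, sub_apply]
    have : S₁ (R v) = S₁ v - (2 * ⟪w, v⟫) • S₁ w := by rw [hR, map_sub, map_smul]
    rw [this]
    abel
  have hquad : ∀ v, ‖S₁ v - S₂ (R v)‖ ^ 2 - 5 / 4 * (⟪d, S₁ v - S₂ (R v)⟫ ^ 2 / ‖d‖ ^ 2) ≤
      ‖(S₁ - S₂) (R v)‖ ^ 2 - μ ^ 2 / 2 * ⟪w, v⟫ ^ 2 := by
    intro v
    rw [hz]
    set s := (S₁ - S₂) (R v)
    set c := ⟪w, v⟫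
    have e1 : ‖s + (2 * c * (μ / ‖d‖)) • d‖ ^ 2 =
        ‖s‖ ^ 2 + 2 * (2 * c * μ) * (⟪d, s⟫ / ‖d‖) + (2 * c * μ) ^ 2 := by
      rw [norm_add_sq_real, real_inner_smul_right, norm_smul, mul_pow, Real.norm_eq_abs, sq_abs,
        real_inner_comm]
      field_simp
    have e2 : ⟪d, s + (2 * c * (μ / ‖d‖)) • d⟫ ^ 2 / ‖d‖ ^ 2 =
        (⟪d, s⟫ / ‖d‖ + 2 * c * μ) ^ 2 := by
      rw [inner_add_right, real_inner_smul_right, real_inner_self_eq_norm_sq, ← div_pow]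
      congr 1
      field_simp
    rw [e1, e2]
    nlinarith [sq_nonneg (⟪d, s⟫ / ‖d‖ * 2 + 2 * c * μ), sq_nonneg (⟪d, s⟫ / ‖d‖)]
  have hbound : ∀ i, √‖d + ρ • (S₁ (B i) - S₂ (R (B i)))‖ +
      √‖d + ρ • (S₁ (-B i) - S₂ (R (-B i)))‖ ≤ √‖d‖ * (2 + h * m / (2 * ‖d‖ ^ 2) *
        (‖(S₁ - S₂) (R (B i))‖ ^ 2 - μ ^ 2 / 2 * ⟪w, B i⟫ ^ 2)) := by
    intro i
    set z := S₁ (B i) - S₂ (R (B i)) with hzdef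
    have hneg : d + ρ • (S₁ (-B i) - S₂ (R (-B i))) = d - ρ • z := by
      simp only [map_neg, hzdef, smul_sub, smul_neg]
      abel
    have hzn : ‖z‖ ≤ ‖S₁‖ + ‖S₂‖ := by
      refine (norm_sub_le _ _).trans (add_le_add ?_ ?_)
      · simpa using S₁.le_opNorm (B i)
      · simpa using S₂.le_opNorm (R (B i))
    have hle : ‖ρ • z‖ ≤ ‖d‖ / 10 := by
      rw [norm_smul, Real.norm_of_nonneg hρ0]
      exact (mul_le_mul_of_nonneg_left hzn hρ0).trans hstep
    rw [hneg]
    refine (sqrt_norm_add_sub_le hd hle).trans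
      (mul_le_mul_of_nonneg_left ?_ (Real.sqrt_nonneg _))
    rw [add_sub_assoc]
    refine add_le_add_right ?_ _
    refine le_trans (le_of_eq ?_) (mul_le_mul_of_nonneg_left (hquad (B i)) (by positivity))
    rw [norm_smul, real_inner_smul_right, mul_pow, mul_pow, Real.norm_of_nonneg hρ0, hρ2]
    field_simp
    ring
  have hsumw : ∑ i, ⟪w, B i⟫ ^ 2 = 1 := by
    have := B.sum_sq_norm_inner_left w
    simpa [hw] using this
  have hsumD : ∑ i, ‖(S₁ - S₂) (R (B i))‖ ^ 2 ≤ m * ‖S₁ - S₂‖ ^ 2 := by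
    simpa using sum_norm_sq_le (B.map R) (S₁ - S₂)
  calc frameAvg B (fun v => √‖d + ρ • (S₁ v - S₂ (R v))‖)
      ≤ (2 * (m : ℝ))⁻¹ * ∑ i, √‖d‖ * (2 + h * m / (2 * ‖d‖ ^ 2) *
        (‖(S₁ - S₂) (R (B i))‖ ^ 2 - μ ^ 2 / 2 * ⟪w, B i⟫ ^ 2)) := by
        unfold frameAvg
        gcongr with i
        exact hbound i
    _ = √‖d‖ * (1 + h / (4 * ‖d‖ ^ 2) *
        (∑ i, ‖(S₁ - S₂) (R (B i))‖ ^ 2 - μ ^ 2 / 2)) := by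
        rw [← Finset.mul_sum, Finset.sum_add_distrib, ← Finset.mul_sum, Finset.sum_sub_distrib,
          ← Finset.mul_sum (a := μ ^ 2 / 2), hsumw]
        simp only [Finset.sum_const, Finset.card_univ, Fintype.card_fin, nsmul_eq_mul]
        field_simp
        ring
    _ ≤ √‖d‖ * (1 + h / (4 * ‖d‖ ^ 2) * (-l / 4)) := by
        gcongr
        nlinarith [sq_nonneg ‖S₁ - S₂‖]
    _ = √‖d‖ * (1 - h * l / (16 * ‖d‖ ^ 2)) := by
        congr 1
        field_simp
        ring

lemma sqrt_mul_one_sub_le {r s κ : ℝ} (hs : 0 ≤ s) (hκ : 0 ≤ κ) (h : s * (1 - κ) ≤ r) :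
    √s * (1 - κ) ≤ √r := by
  rcases le_total (1 - κ) 0 with h1 | h1
  · exact (mul_nonpos_of_nonneg_of_nonpos (Real.sqrt_nonneg _) h1).trans (Real.sqrt_nonneg _)
  · refine Real.le_sqrt_of_sq_le ?_
    rw [mul_pow, Real.sq_sqrt hs]
    nlinarith [mul_nonneg (mul_nonneg hs h1) hκ]

end Reflection

section Regularity

variable {E F : Type*} [NormedAddCommGroup E] [InnerProductSpace ℝ E]
  [NormedAddCommGroup F] [InnerProductSpace ℝ F] {m : ℕ}
  {h : ℝ} {b : E → E} {S : E → F →L[ℝ] E} {f : E → ℝ} {C Cb Cs L M η : ℝ}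

/-- One step of reflection coupling does not increase `√‖x - y‖` on average. -/
lemma exists_frameAvg_sqrt_le (hm : 0 < m) (hh : 0 ≤ h) {l : ℝ} {x y : E}
    (hb : ∀ x, ‖b x‖ ≤ Cb) (hS : ∀ x, ‖S x‖ ≤ Cs)
    (hell : ∀ e : E, ‖e‖ = 1 → ∃ w : F, ∃ μ : ℝ, ‖w‖ = 1 ∧ l ≤ μ ^ 2 ∧ S x w = μ • e)
    (hosc : 5 * m * ‖S x - S y‖ ^ 2 ≤ l) (hxy : 0 < ‖x - y‖)
    (hr : 64 * Cb * ‖x - y‖ ≤ l) (hdrift : 4 * Cb * h ≤ ‖x - y‖)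
    (hnoise : √(h * m) * (40 * Cs) ≤ ‖x - y‖) (B : OrthonormalBasis (Fin m) ℝ F) :
    ∃ R : F ≃ₗᵢ[ℝ] F, frameAvg B
      (fun v => √‖stepPt m h b S x v - stepPt m h b S y (R v)‖) ≤ √‖x - y‖ := by
  set d := x - y + h • (b x - b y) with hd
  have hsm : ‖h • (b x - b y)‖ ≤ 2 * Cb * h := by
    rw [norm_smul, Real.norm_of_nonneg hh]
    have := (norm_sub_le (b x) (b y)).trans (add_le_add (hb x) (hb y))
    nlinarith
  have hd1 : ‖d‖ ≤ ‖x - y‖ + 2 * Cb * h := (norm_add_le _ _).trans (by gcongr)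
  have hd2 : ‖x - y‖ - 2 * Cb * h ≤ ‖d‖ := by
    have := norm_sub_le_norm_add (x - y) (h • (b x - b y))
    linarith
  have hd0 : 0 < ‖d‖ := by linarith
  have hdne : d ≠ 0 := norm_pos_iff.1 hd0
  obtain ⟨w, μ, hw, hμ, hSw⟩ := hell (‖d‖⁻¹ • d) (by
    rw [norm_smul, norm_inv, norm_norm, inv_mul_cancel₀ hd0.ne'])
  rw [smul_smul, ← div_eq_mul_inv] at hSw
  obtain ⟨R, hR⟩ := exists_reflection_frameAvg_le (h := h) hm hh hdne hw hSw hμ hosc (by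
    have : √(h * m) * (‖S x‖ + ‖S y‖) ≤ √(h * m) * (Cs + Cs) := by
      gcongr
      · exact hS x
      · exact hS y
    linarith) B
  refine ⟨R, ?_⟩
  have e : ∀ v, stepPt m h b S x v - stepPt m h b S y (R v) =
      d + √(h * m) • (S x v - S y (R v)) := by
    intro v
    simp only [stepPt, hd, smul_sub]
    abel
  simp only [e]
  have hl : 0 ≤ l := le_trans (by positivity) hosc
  refine hR.trans (sqrt_mul_one_sub_le hd0.le (by positivity) ?_)
  have hCb : 0 ≤ Cb := (norm_nonneg _).trans (hb x)
  have h1 : 2 * Cb * ‖d‖ ≤ l / 16 := by nlinarith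
  have h2 : ‖d‖ * (1 - h * l / (16 * ‖d‖ ^ 2)) = ‖d‖ - h * (l / 16) / ‖d‖ := by
    field_simp
  have h3 : 2 * Cb * h ≤ h * (l / 16) / ‖d‖ := by
    rw [le_div_iff₀ hd0]
    nlinarith
  linarith

variable [Nonempty (OrthonormalBasis (Fin m) ℝ F)]

/-- Modulus of continuity at step `k` from synchronous coupling. -/
lemma schemeIter_sub_le_sync (hm : 0 < m) (hh : 0 ≤ h) (hh1 : h ≤ 1) (hL : 0 ≤ L) (hM : 0 ≤ M)
    (hbL : ∀ x y, ‖b x - b y‖ ≤ L * ‖x - y‖) (hSL : ∀ x y, ‖S x - S y‖ ≤ L * ‖x - y‖)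
    (hf : ∀ x, |f x| ≤ C) (hmod : ∀ x y, f x - f y ≤ η + M * ‖x - y‖ ^ 2) (k : ℕ) (x y : E) :
    schemeIter m h b S f k x - schemeIter m h b S f k y ≤
      η + M * (1 + (2 * L + L ^ 2 + m * L ^ 2) * h) ^ k * ‖x - y‖ ^ 2 := by
  induction k generalizing x y with
  | zero => simpa [schemeIter] using hmod x y
  | succ k ih =>
    refine schemeStep_sub_le hm (abs_schemeIter_le hm hf k) fun B =>
      ⟨LinearIsometryEquiv.refl ℝ F, ?_⟩
    refine (frameAvg_le_frameAvg fun v => ih _ _).trans ?_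
    rw [frameAvg_add, frameAvg_const hm, frameAvg_const_mul]
    have := frameAvg_sync_le (b := b) (S := S) hm hh hh1 (hbL x y) (hSL x y) B
    calc _ ≤ η + M * (1 + (2 * L + L ^ 2 + m * L ^ 2) * h) ^ k *
          ((1 + (2 * L + L ^ 2 + m * L ^ 2) * h) * ‖x - y‖ ^ 2) := by
          gcongr
          exact this
      _ = _ := by ring

/-- Deviation of the scheme from its initial datum. -/
lemma abs_schemeIter_sub_init_le (hm : 0 < m) (hh : 0 ≤ h) (hh1 : h ≤ 1) (hM : 0 ≤ M)
    (hb : ∀ x, ‖b x‖ ≤ Cb) (hS : ∀ x, ‖S x‖ ≤ Cs) (hf : ∀ x, |f x| ≤ C)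
    (hmod : ∀ x y, f x - f y ≤ η + M * ‖x - y‖ ^ 2) (k : ℕ) (x : E) :
    |schemeIter m h b S f k x - f x| ≤
      η + M * ((1 + (Cb + Cb ^ 2 + m * Cs ^ 2) * h) ^ k - 1) := by
  set q := 1 + (Cb + Cb ^ 2 + m * Cs ^ 2) * h with hq
  have hw := frameAvg_weight_le (m := m) hm hh hh1 hb hS (x₀ := x)
  have upper : ∀ k y, schemeIter m h b S f k y ≤
      (f x + η - M) + M * q ^ k * (1 + ‖y - x‖ ^ 2) := by
    intro k
    induction k with
    | zero => intro y; simp only [schemeIter]; linarith [hmod y x]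
    | succ k ih =>
      intro y
      refine schemeStep_le fun B => ?_
      refine (frameAvg_le_frameAvg fun v => ih _).trans ?_
      rw [frameAvg_add, frameAvg_const hm, frameAvg_const_mul, pow_succ, ← mul_assoc,
        mul_assoc (M * q ^ k)]
      have hCb : 0 ≤ Cb := (norm_nonneg _).trans (hb x)
      gcongr
      exact hw B y
  have lower : ∀ k y, (f x - η + M) + -(M * q ^ k) * (1 + ‖y - x‖ ^ 2) ≤
      schemeIter m h b S f k y := by
    intro k
    induction k with
    | zero =>
      intro y
      have := hmod x y
      rw [norm_sub_rev] at this
      simp only [schemeIter]; linarith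
    | succ k ih =>
      intro y
      obtain ⟨B⟩ := ‹Nonempty (OrthonormalBasis (Fin m) ℝ F)›
      refine le_trans ?_ (frameAvg_le_schemeStep hm (abs_schemeIter_le hm hf k) y B)
      refine le_trans ?_ (frameAvg_le_frameAvg fun v => ih _)
      rw [frameAvg_add, frameAvg_const hm, frameAvg_const_mul]
      have hCb : 0 ≤ Cb := (norm_nonneg _).trans (hb x)
      have : M * q ^ k * frameAvg B (fun v => 1 + ‖stepPt m h b S y v - x‖ ^ 2) ≤
          M * q ^ k * (q * (1 + ‖y - x‖ ^ 2)) := by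
        gcongr
        exact hw B y
      rw [pow_succ]
      linarith
  have h1 := upper k x
  have h2 := lower k x
  simp only [sub_self, norm_zero] at h1 h2
  rw [abs_le]
  constructor <;> linarith

/-- Local modulus of continuity, uniform with respect to the Lipschitz constants of the
coefficients. -/
lemma schemeIter_sub_le_local (hm : 0 < m) (hh : 0 ≤ h) (hh1 : h ≤ 1) (hL : 0 ≤ L) (hM : 0 ≤ M)
    (hη : 0 ≤ η) (hbL : ∀ x y, ‖b x - b y‖ ≤ L * ‖x - y‖)
    (hSL : ∀ x y, ‖S x - S y‖ ≤ L * ‖x - y‖)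
    (hb : ∀ x, ‖b x‖ ≤ Cb) (hS : ∀ x, ‖S x‖ ≤ Cs) (hf : ∀ x, |f x| ≤ C)
    (hmod : ∀ x y, f x - f y ≤ η + M * ‖x - y‖ ^ 2)
    {R r₀ ρ l K T : ℝ} (hR : 0 < R)
    (hell : ∀ x, ‖x‖ ≤ R → ∀ e : E, ‖e‖ = 1 →
      ∃ w : F, ∃ μ : ℝ, ‖w‖ = 1 ∧ l ≤ μ ^ 2 ∧ S x w = μ • e)
    (hosc : ∀ x y, ‖x‖ ≤ R → ‖y‖ ≤ R → ‖x - y‖ ≤ r₀ → 5 * m * ‖S x - S y‖ ^ 2 ≤ l)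
    (hr₀1 : r₀ ≤ 1) (hr₀ : 64 * Cb * r₀ ≤ l) (hK : 1 ≤ K) (hKM : M ≤ K)
    (hKr : 2 * C ≤ K * √r₀) (hρ : 0 < ρ)
    (hρM : M * Real.exp ((2 * L + L ^ 2 + m * L ^ 2) * T) * ρ ≤ 1)
    (hdrift : 4 * Cb * h ≤ ρ) (hnoise : √(h * m) * (40 * Cs) ≤ ρ)
    (k : ℕ) (hk : k * h ≤ T) (x y : E) :
    schemeIter m h b S f k x - schemeIter m h b S f k y ≤
      K * √‖x - y‖ + η + 2 * C / R ^ 2 * (1 + (Cb + Cb ^ 2 + m * Cs ^ 2) * h) ^ k *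
        ((1 + ‖x - 0‖ ^ 2) + (1 + ‖y - 0‖ ^ 2)) := by
  set q := 1 + (Cb + Cb ^ 2 + m * Cs ^ 2) * h with hq
  have hCb : 0 ≤ Cb := (norm_nonneg _).trans (hb x)
  have hC : 0 ≤ C := (abs_nonneg _).trans (hf x)
  have hq1 : 1 ≤ q := by rw [hq]; linarith [show 0 ≤ (Cb + Cb ^ 2 + m * Cs ^ 2) * h by positivity]
  induction k generalizing x y with
  | zero =>
    simp only [schemeIter, pow_zero, mul_one]
    have tail : 0 ≤ 2 * C / R ^ 2 * ((1 + ‖x - 0‖ ^ 2) + (1 + ‖y - 0‖ ^ 2)) := by positivity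
    rcases le_total r₀ ‖x - y‖ with h1 | h1
    · have h2 : K * √r₀ ≤ K * √‖x - y‖ := by gcongr
      have := (abs_le.1 (hf x)).2
      have := (abs_le.1 (hf y)).1
      linarith
    · have h3 : ‖x - y‖ ^ 2 ≤ √‖x - y‖ := by
        refine Real.le_sqrt_of_sq_le ?_
        have h4 := h1.trans hr₀1
        calc (‖x - y‖ ^ 2) ^ 2 = ‖x - y‖ ^ 4 := by ring
          _ ≤ ‖x - y‖ ^ 1 := pow_le_pow_of_le_one (norm_nonneg _) h4 (by norm_num)
          _ = ‖x - y‖ := pow_one _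
      have h5 : M * ‖x - y‖ ^ 2 ≤ K * √‖x - y‖ := by gcongr
      linarith [hmod x y]
  | succ k ih =>
    have hk' : (k : ℝ) * h ≤ T := by push_cast at hk; linarith
    have hqk : 1 ≤ q ^ (k + 1) := one_le_pow₀ hq1
    have hsq : 0 ≤ K * √‖x - y‖ := by positivity
    have triv : schemeIter m h b S f (k + 1) x - schemeIter m h b S f (k + 1) y ≤ 2 * C := by
      have := (abs_le.1 (abs_schemeIter_le (h := h) (b := b) (S := S) hm hf (k + 1) x)).2
      have := (abs_le.1 (abs_schemeIter_le (h := h) (b := b) (S := S) hm hf (k + 1) y)).1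
      linarith
    have tail0 : 0 ≤ 2 * C / R ^ 2 * q ^ (k + 1) *
        ((1 + ‖x - 0‖ ^ 2) + (1 + ‖y - 0‖ ^ 2)) := by positivity
    have far : ∀ s, R ^ 2 ≤ s → 2 * C ≤ 2 * C / R ^ 2 * q ^ (k + 1) * s := by
      intro s hs
      calc 2 * C = 2 * C / R ^ 2 * 1 * R ^ 2 := by field_simp
        _ ≤ _ := by gcongr
    rcases lt_or_ge R ‖x‖ with hx | hx
    · have := far ((1 + ‖x - 0‖ ^ 2) + (1 + ‖y - 0‖ ^ 2)) (by
        simp only [sub_zero]; nlinarith [sq_nonneg ‖y‖])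
      linarith
    rcases lt_or_ge R ‖y‖ with hy | hy
    · have := far ((1 + ‖x - 0‖ ^ 2) + (1 + ‖y - 0‖ ^ 2)) (by
        simp only [sub_zero]; nlinarith [sq_nonneg ‖x‖])
      linarith
    rcases le_total r₀ ‖x - y‖ with h1 | h1
    · have h2 : K * √r₀ ≤ K * √‖x - y‖ := by gcongr
      linarith
    rcases le_total ‖x - y‖ ρ with h2 | h2
    · have h3 := schemeIter_sub_le_sync hm hh hh1 hL hM hbL hSL hf hmod (k + 1) x y
      have h4 : (1 + (2 * L + L ^ 2 + m * L ^ 2) * h) ^ (k + 1) ≤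
          Real.exp ((2 * L + L ^ 2 + m * L ^ 2) * T) := by
        calc (1 + (2 * L + L ^ 2 + m * L ^ 2) * h) ^ (k + 1) ≤
            Real.exp ((2 * L + L ^ 2 + m * L ^ 2) * h) ^ (k + 1) := by
              gcongr
              linarith [Real.add_one_le_exp ((2 * L + L ^ 2 + m * L ^ 2) * h)]
          _ = Real.exp ((2 * L + L ^ 2 + m * L ^ 2) * ((k + 1 : ℕ) * h)) := by
              rw [← Real.exp_nat_mul]; ring_nf
          _ ≤ _ := by gcongr
      have h5 : M * (1 + (2 * L + L ^ 2 + m * L ^ 2) * h) ^ (k + 1) * ‖x - y‖ ^ 2 ≤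
          ‖x - y‖ := by
        calc _ ≤ M * Real.exp ((2 * L + L ^ 2 + m * L ^ 2) * T) * (ρ * ‖x - y‖) := by
              gcongr
              rw [sq]
              gcongr
          _ = M * Real.exp ((2 * L + L ^ 2 + m * L ^ 2) * T) * ρ * ‖x - y‖ := by ring
          _ ≤ 1 * ‖x - y‖ := by gcongr
          _ = ‖x - y‖ := one_mul _
      have h6 : ‖x - y‖ ≤ 1 * √‖x - y‖ := by
        rw [one_mul]
        refine Real.le_sqrt_of_sq_le ?_
        nlinarith [norm_nonneg (x - y)]
      have h7 : 1 * √‖x - y‖ ≤ K * √‖x - y‖ := by gcongr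
      linarith
    · refine schemeStep_sub_le hm (abs_schemeIter_le hm hf k) fun B => ?_
      obtain ⟨Q, hQ⟩ := exists_frameAvg_sqrt_le (b := b) (S := S) hm hh hb hS (hell x hx)
        (hosc x y hx hy h1) (hρ.trans_le h2)
        ((mul_le_mul_of_nonneg_left h1 (by positivity)).trans hr₀)
        (hdrift.trans h2) (hnoise.trans h2) B
      refine ⟨Q, (frameAvg_le_frameAvg fun v => ih hk' _ _).trans ?_⟩
      rw [frameAvg_add, frameAvg_add, frameAvg_const hm, frameAvg_const_mul, frameAvg_const_mul,
        frameAvg_add]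
      have hx1 := frameAvg_weight_le (m := m) hm hh hh1 hb hS B 0 x
      have hy1 := frameAvg_weight_le (m := m) hm hh hh1 hb hS (B.map Q) 0 y
      have hy2 : frameAvg (B.map Q) (fun v => 1 + ‖stepPt m h b S y v - 0‖ ^ 2) =
          frameAvg B (fun v => 1 + ‖stepPt m h b S y (Q v) - 0‖ ^ 2) := by
        simp [frameAvg]
      rw [hy2] at hy1
      calc _ ≤ K * √‖x - y‖ + η + 2 * C / R ^ 2 * q ^ k *
            (q * (1 + ‖x - 0‖ ^ 2) + q * (1 + ‖y - 0‖ ^ 2)) := by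
            gcongr
        _ = _ := by ring

end Regularity

section Stability

open Filter Topology

variable {E F : Type*} [NormedAddCommGroup E] [InnerProductSpace ℝ E]
  [NormedAddCommGroup F] [InnerProductSpace ℝ F] {m : ℕ}

lemma abs_inner_apply_sub_le (A : E →L[ℝ] E) (v w : E) :
    |⟪v, A v⟫ - ⟪w, A w⟫| ≤ ‖A‖ * (‖v‖ + ‖w‖) * ‖v - w‖ := by
  have e : ⟪v, A v⟫ - ⟪w, A w⟫ = ⟪v - w, A v⟫ + ⟪w, A (v - w)⟫ := by
    simp only [map_sub, inner_sub_left, inner_sub_right]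
    ring
  rw [e]
  refine (abs_add_le _ _).trans ?_
  have h1 := (abs_real_inner_le_norm (v - w) (A v)).trans
    (mul_le_mul_of_nonneg_left (A.le_opNorm v) (norm_nonneg _))
  have h2 := (abs_real_inner_le_norm w (A (v - w))).trans
    (mul_le_mul_of_nonneg_left (A.le_opNorm (v - w)) (norm_nonneg _))
  linarith

lemma sum_inner_apply_le (A : E →L[ℝ] E) {D D' : F →L[ℝ] E} {Cs : ℝ} (hD : ‖D‖ ≤ Cs)
    (hD' : ‖D'‖ ≤ Cs) (B : OrthonormalBasis (Fin m) ℝ F) :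
    ∑ i, ⟪D (B i), A (D (B i))⟫ ≤
      ∑ i, ⟪D' (B i), A (D' (B i))⟫ + m * (‖A‖ * (2 * Cs) * ‖D - D'‖) := by
  have : ∀ i, ⟪D (B i), A (D (B i))⟫ ≤
      ⟪D' (B i), A (D' (B i))⟫ + ‖A‖ * (2 * Cs) * ‖D - D'‖ := by
    intro i
    have h1 := (abs_le.1 (abs_inner_apply_sub_le A (D (B i)) (D' (B i)))).2
    have h2 : ‖D (B i)‖ ≤ Cs := by simpa using (D.le_opNorm (B i)).trans (by simpa using hD)
    have h3 : ‖D' (B i)‖ ≤ Cs := by simpa using (D'.le_opNorm (B i)).trans (by simpa using hD')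
    have h4 : ‖D (B i) - D' (B i)‖ ≤ ‖D - D'‖ := by simpa using (D - D').le_opNorm (B i)
    have h5 : ‖A‖ * (‖D (B i)‖ + ‖D' (B i)‖) * ‖D (B i) - D' (B i)‖ ≤
        ‖A‖ * (2 * Cs) * ‖D - D'‖ := by
      have : 0 ≤ Cs := (norm_nonneg _).trans hD
      gcongr
      linarith
    linarith
  calc _ ≤ ∑ i, (⟪D' (B i), A (D' (B i))⟫ + ‖A‖ * (2 * Cs) * ‖D - D'‖) :=
        Finset.sum_le_sum fun i _ => this i
    _ = _ := by simp [Finset.sum_add_distrib]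

/-- A quadratic polynomial which is a strict supersolution at `(x₀, t₀)` is a supersolution of
the scheme near `(x₀, t₀)`. -/
lemma frameAvg_test_le (hm : 0 < m) {h : ℝ} (hh : 0 ≤ h) {b : E → E} {S : E → F →L[ℝ] E}
    {Cb Cs ε κ a : ℝ} {S₀ : F →L[ℝ] E} {b₀ p x₀ y : E} (A : E →L[ℝ] E)
    (hb : ‖b y‖ ≤ Cb) (hS : ‖S y‖ ≤ Cs) (hS₀ : ‖S₀‖ ≤ Cs)
    (hbε : ‖b y - b₀‖ ≤ ε) (hSε : ‖S y - S₀‖ ≤ ε) (hy : ‖y - x₀‖ ≤ ε) (hhε : h ≤ ε)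
    (B : OrthonormalBasis (Fin m) ℝ F)
    (hgap : 2⁻¹ * ∑ i, ⟪S₀ (B i), A (S₀ (B i))⟫ + ⟪p, b₀⟫ + κ ≤ a)
    (hε : (m * (‖A‖ * Cs) + ‖p‖ + ‖A‖ * Cb + 2⁻¹ * (‖A‖ * Cb ^ 2)) * ε ≤ κ) :
    frameAvg B (fun v => ⟪p, stepPt m h b S y v - x₀⟫ +
        2⁻¹ * ⟪stepPt m h b S y v - x₀, A (stepPt m h b S y v - x₀)⟫) ≤
      ⟪p, y - x₀⟫ + 2⁻¹ * ⟪y - x₀, A (y - x₀)⟫ + a * h := by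
  have e : ∀ v, stepPt m h b S y v - x₀ = (y - x₀ + h • b y) + √(h * m) • S y v := by
    intro v; unfold stepPt; abel
  simp only [e]
  rw [frameAvg_quadratic hm hh]
  have hCb : 0 ≤ Cb := (norm_nonneg _).trans hb
  have hCs : 0 ≤ Cs := (norm_nonneg _).trans hS
  have hε0 : 0 ≤ ε := hh.trans hhε
  have h1 := sum_inner_apply_le A hS hS₀ B
  have h1' : m * (‖A‖ * (2 * Cs) * ‖S y - S₀‖) ≤ m * (‖A‖ * (2 * Cs) * ε) := by gcongr
  have h2 : ⟪p, b y⟫ ≤ ⟪p, b₀⟫ + ‖p‖ * ε := by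
    have h3 := (real_inner_le_norm p (b y - b₀)).trans
      (mul_le_mul_of_nonneg_left hbε (norm_nonneg _))
    rw [inner_sub_right] at h3
    linarith
  have hA : ∀ v w : E, ⟪v, A w⟫ ≤ ‖A‖ * ‖v‖ * ‖w‖ := fun v w => by
    have := (real_inner_le_norm v (A w)).trans
      (mul_le_mul_of_nonneg_left (A.le_opNorm w) (norm_nonneg _))
    linarith
  have h4 : ⟪y - x₀, A (b y)⟫ ≤ ‖A‖ * ε * Cb := (hA _ _).trans (by gcongr)
  have h5 : ⟪b y, A (y - x₀)⟫ ≤ ‖A‖ * Cb * ε := (hA _ _).trans (by gcongr)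
  have h6 : h * ⟪b y, A (b y)⟫ ≤ ε * (‖A‖ * Cb * Cb) := by
    calc h * ⟪b y, A (b y)⟫ ≤ h * (‖A‖ * Cb * Cb) := by
          gcongr
          exact (hA _ _).trans (by gcongr)
      _ ≤ _ := by gcongr
  simp only [map_add, map_smul, inner_add_left, inner_add_right, real_inner_smul_left,
    real_inner_smul_right]
  have h7 : ⟪p, b y⟫ + 2⁻¹ * (⟪y - x₀, A (b y)⟫ + ⟪b y, A (y - x₀)⟫ + h * ⟪b y, A (b y)⟫)
      + 2⁻¹ * ∑ i, ⟪S y (B i), A (S y (B i))⟫ ≤ a := by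
    linarith
  have h8 := mul_le_mul_of_nonneg_right h7 hh
  linarith

/-- Limits of a locally monotone consistent scheme cannot be touched from above by a strict
supersolution. -/
lemma scheme_limit_not_touched (hm : 0 < m) {l : Filter ℕ} [l.NeBot] {h : ℕ → ℝ}
    (hpos : ∀ N, 0 < h N) (hlim : Tendsto h l (𝓝 0)) {b : ℕ → E → E} {S : ℕ → E → F →L[ℝ] E}
    {Cb Cs T : ℝ} (hb : ∀ N x, ‖b N x‖ ≤ Cb) (hS : ∀ N x, ‖S N x‖ ≤ Cs)
    {W : ℕ → ℕ → E → ℝ}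
    (hstep : ∀ N k y (ψ : E → ℝ) c,
      (∀ v : F, ‖v‖ = 1 → W N k (stepPt m (h N) (b N) (S N) y v) ≤
        ψ (stepPt m (h N) (b N) (S N) y v)) →
      (∀ B : OrthonormalBasis (Fin m) ℝ F,
        frameAvg B (fun v => ψ (stepPt m (h N) (b N) (S N) y v)) ≤ c) → W N (k + 1) y ≤ c)
    {u : E → ℝ → ℝ} {x₀ : E} {t₀ : ℝ} (ht₀ : t₀ ∈ Ioo 0 T)
    (hconv : ∀ r, ∀ η > 0, ∀ᶠ N in l, ∀ y, ‖y‖ ≤ r → ∀ t ∈ Icc 0 T,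
      |W N ⌊t / h N⌋₊ y - u y t| ≤ η)
    {b₀ : E} {S₀ : F →L[ℝ] E} (hS₀ : ‖S₀‖ ≤ Cs)
    (hcoef : ∀ ε > 0, ∃ δ > 0, ∀ᶠ N in l, ∀ y, ‖y - x₀‖ ≤ δ →
      ‖b N y - b₀‖ ≤ ε ∧ ‖S N y - S₀‖ ≤ ε)
    {A : E →L[ℝ] E} {p : E} {a δ η κ : ℝ} (hδ : 0 < δ) (hη : 0 < η) (hκ : 0 < κ)
    (htouch : ∀ y s, ‖y - x₀‖ ≤ δ → t₀ - δ ≤ s → s ≤ t₀ →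
      u y s ≤ u x₀ t₀ + a * (s - t₀) + ⟪p, y - x₀⟫ + 2⁻¹ * ⟪y - x₀, A (y - x₀)⟫
        - η * ((t₀ - s) + ‖y - x₀‖ ^ 2))
    (hgap : ∀ B : OrthonormalBasis (Fin m) ℝ F,
      2⁻¹ * ∑ i, ⟪S₀ (B i), A (S₀ (B i))⟫ + ⟪p, b₀⟫ + κ ≤ a) : False := by
  obtain ⟨N₀⟩ : Nonempty ℕ := ⟨0⟩
  have hCb : 0 ≤ Cb := (norm_nonneg _).trans (hb N₀ x₀)
  have hCs : 0 ≤ Cs := (norm_nonneg _).trans hS₀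
  set Q := m * (‖A‖ * Cs) + ‖p‖ + ‖A‖ * Cb + 2⁻¹ * (‖A‖ * Cb ^ 2) with hQ
  have hQ0 : 0 ≤ Q := by positivity
  obtain ⟨ε, hε, hεκ⟩ : ∃ ε > 0, Q * ε ≤ κ :=
    ⟨κ / (Q + 1), by positivity, by
      rw [mul_div_assoc', div_le_iff₀ (by positivity)]
      nlinarith⟩
  obtain ⟨δ₁, hδ₁, hcoef⟩ := hcoef ε hε
  obtain ⟨r, hr, hrδ, hrδ₁, hrt, hrε⟩ : ∃ r > 0, r ≤ δ ∧ r ≤ δ₁ ∧ r ≤ t₀ ∧ r ≤ ε :=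
    ⟨min (min δ δ₁) (min t₀ ε), lt_min (lt_min hδ hδ₁) (lt_min ht₀.1 hε),
      (min_le_left _ _).trans (min_le_left _ _), (min_le_left _ _).trans (min_le_right _ _),
      (min_le_right _ _).trans (min_le_left _ _), (min_le_right _ _).trans (min_le_right _ _)⟩
  obtain ⟨c, hc, hc1, hc2⟩ : ∃ c > 0, 2 * c ≤ η * (r / 2) ∧ 2 * c ≤ η * (r / 2) ^ 2 :=
    ⟨min (η * (r / 2)) (η * (r / 2) ^ 2) / 2, by positivity,
      by linarith [min_le_left (η * (r / 2)) (η * (r / 2) ^ 2)],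
      by linarith [min_le_right (η * (r / 2)) (η * (r / 2) ^ 2)]⟩
  have hsmall : ∀ᶠ N in l, h N ≤ ε ∧ h N ≤ r / 2 ∧ |a| * h N ≤ c / 4 ∧
      h N * Cb + √(h N * m) * Cs ≤ r / 2 := by
    have t1 : Tendsto (fun N => |a| * h N) l (𝓝 0) := by simpa using hlim.const_mul |a|
    have t2 : Tendsto (fun N => h N * Cb + √(h N * m) * Cs) l (𝓝 0) := by
      have := (hlim.mul_const Cb).add
        (((Real.continuous_sqrt.tendsto _).comp (hlim.mul_const (m : ℝ))).mul_const Cs)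
      simpa [Function.comp_def] using this
    filter_upwards [hlim.eventually_le_const hε, hlim.eventually_le_const (half_pos hr),
      t1.eventually_le_const (show 0 < c / 4 by positivity),
      t2.eventually_le_const (half_pos hr)] with N h1 h2 h3 h4
    exact ⟨h1, h2, h3, h4⟩
  obtain ⟨N, ⟨hNε, hNr, hNa, hNs⟩, hNcoef, hNc⟩ :=
    (hsmall.and (hcoef.and (hconv (‖x₀‖ + r) (c / 4) (by positivity)))).exists
  have hN := hpos N
  have hfloor : ∀ k : ℕ, ⌊(k * h N) / h N⌋₊ = k := fun k => by
    rw [mul_div_cancel_right₀ _ hN.ne', Nat.floor_natCast]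
  have hnorm : ∀ y, ‖y - x₀‖ ≤ r → ‖y‖ ≤ ‖x₀‖ + r := fun y hy => by
    have := norm_le_norm_add_norm_sub' y x₀
    linarith
  let φ : E → ℝ → ℝ := fun y s => u x₀ t₀ + a * (s - t₀) - c +
    (⟪p, y - x₀⟫ + 2⁻¹ * ⟪y - x₀, A (y - x₀)⟫)
  have margin : ∀ (k : ℕ) y, ‖y - x₀‖ ≤ r → t₀ - r ≤ k * h N → k * h N ≤ t₀ →
      (k * h N ≤ t₀ - r / 2 ∨ r / 2 ≤ ‖y - x₀‖) → W N k y ≤ φ y (k * h N) := by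
    intro k y hy hk1 hk2 hor
    have h1 := htouch y (k * h N) (hy.trans hrδ) (by linarith) hk2
    have h2 := hNc y (hnorm y hy) (k * h N) ⟨by positivity, by linarith [ht₀.2]⟩
    rw [hfloor] at h2
    have h2 := (abs_le.1 h2).2
    have h3 : 2 * c ≤ η * ((t₀ - k * h N) + ‖y - x₀‖ ^ 2) := by
      rcases hor with h4 | h4
      · exact hc1.trans (mul_le_mul_of_nonneg_left (by nlinarith [sq_nonneg ‖y - x₀‖]) hη.le)
      · refine hc2.trans (mul_le_mul_of_nonneg_left ?_ hη.le)
        have : (r / 2) ^ 2 ≤ ‖y - x₀‖ ^ 2 := by gcongr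
        linarith
    simp only [φ]
    linarith
  have claim : ∀ (k : ℕ) y, ‖y - x₀‖ ≤ r → t₀ - r ≤ k * h N → k * h N ≤ t₀ →
      W N k y ≤ φ y (k * h N) := by
    intro k
    induction k with
    | zero =>
      intro y hy hk1 hk2
      exact margin 0 y hy hk1 hk2 (Or.inl (by simp; linarith))
    | succ k ih =>
      intro y hy hk1 hk2
      by_cases hor : ((k + 1 : ℕ) : ℝ) * h N ≤ t₀ - r / 2 ∨ r / 2 ≤ ‖y - x₀‖
      · exact margin _ y hy hk1 hk2 hor
      push Not at hor
      obtain ⟨ha, hb'⟩ := hor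
      push_cast at ha hk2
      refine hstep N k y (fun z => φ z (k * h N)) _ (fun v hv => ?_) fun B => ?_
      · refine ih _ ?_ (by linarith) (by linarith)
        have e : stepPt m (h N) (b N) (S N) y v - x₀ =
            (y - x₀) + (h N • b N y + √(h N * m) • S N y v) := by
          unfold stepPt; abel
        rw [e]
        have h1 : ‖h N • b N y‖ ≤ h N * Cb := by
          rw [norm_smul, Real.norm_of_nonneg hN.le]
          gcongr
          exact hb N y
        have h2 : ‖√(h N * m) • S N y v‖ ≤ √(h N * m) * Cs := by
          rw [norm_smul, Real.norm_of_nonneg (Real.sqrt_nonneg _)]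
          gcongr
          have := (S N y).le_opNorm v
          rw [hv, mul_one] at this
          exact this.trans (hS N y)
        have h3 := norm_add_le (y - x₀) (h N • b N y + √(h N * m) • S N y v)
        have h4 := norm_add_le (h N • b N y) (√(h N * m) • S N y v)
        linarith
      · have hy' := hNcoef y (hy.trans hrδ₁)
        have := frameAvg_test_le hm hN.le A (hb N y) (hS N y) hS₀ hy'.1 hy'.2 (hy.trans hrε) hNε
          B (hgap B) hεκ
        simp only [φ]
        rw [frameAvg_add, frameAvg_const hm]
        push_cast
        linarith
  have hk2 : (⌊t₀ / h N⌋₊ : ℝ) * h N ≤ t₀ := by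
    rw [← le_div_iff₀ hN]
    exact Nat.floor_le (div_nonneg ht₀.1.le hN.le)
  have hk1 : t₀ - h N ≤ (⌊t₀ / h N⌋₊ : ℝ) * h N := by
    have := (Nat.lt_floor_add_one (t₀ / h N)).le
    rw [div_le_iff₀ hN] at this
    linarith
  have h1 := claim ⌊t₀ / h N⌋₊ x₀ (by simpa using hr.le) (by linarith) hk2
  have h2 := (abs_le.1 (hNc x₀ (by linarith) t₀ ⟨ht₀.1.le, ht₀.2.le⟩)).1
  simp only [φ, sub_self, inner_zero_right, map_zero] at h1
  have h3 : a * (⌊t₀ / h N⌋₊ * h N - t₀) ≤ |a| * h N := by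
    calc a * (⌊t₀ / h N⌋₊ * h N - t₀) ≤ |a| * |⌊t₀ / h N⌋₊ * h N - t₀| := by
          rw [← abs_mul]; exact le_abs_self _
      _ ≤ |a| * h N := by
          gcongr
          rw [abs_le]
          constructor <;> linarith
  linarith

end Stability

section Compactness

open Filter Topology

/-- Pointwise limits of bounded families exist along an ultrafilter. -/
lemma exists_ultralimit {X : Type*} (l : Ultrafilter ℕ) {u : ℕ → X → ℝ} {C : ℝ}
    (hu : ∀ N x, |u N x| ≤ C) : ∃ v : X → ℝ, ∀ x, |v x| ≤ C ∧ Tendsto (u · x) l (𝓝 (v x)) := by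
  have : ∀ x, ∃ c ∈ Icc (-C) C, Tendsto (u · x) l (𝓝 c) := fun x =>
    isCompact_Icc.ultrafilter_le_nhds (l.map (u · x))
      (le_principal_iff.2 (mem_map.2 (univ_mem' fun N => abs_le.1 (hu N x))))
  choose v hv hlim using this
  exact ⟨v, fun x => ⟨abs_le.2 (hv x), hlim x⟩⟩

variable {X : Type*} {l : Filter ℕ} [l.NeBot] {u : ℕ → X → ℝ} {v : X → ℝ} {K : Set X}

lemma abs_sub_le_of_tendsto {x y : X} {η : ℝ} (hx : Tendsto (u · x) l (𝓝 (v x)))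
    (hy : Tendsto (u · y) l (𝓝 (v y))) (h : ∀ᶠ N in l, |u N x - u N y| ≤ η) :
    |v x - v y| ≤ η :=
  le_of_tendsto ((hx.sub hy).abs) h

variable [PseudoMetricSpace X]

lemma continuousOn_of_asymptotic_equicontinuous
    (hlim : ∀ x ∈ K, Tendsto (u · x) l (𝓝 (v x)))
    (heq : ∀ η > 0, ∃ δ > 0, ∀ᶠ N in l, ∀ x ∈ K, ∀ y ∈ K, dist x y < δ →
      |u N x - u N y| ≤ η) : ContinuousOn v K := by
  rw [Metric.continuousOn_iff]
  intro x hx η hη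
  obtain ⟨δ, hδ, h⟩ := heq (η / 2) (half_pos hη)
  refine ⟨δ, hδ, fun y hy hyx => ?_⟩
  rw [Real.dist_eq]
  refine (abs_sub_le_of_tendsto (hlim y hy) (hlim x hx) ?_).trans_lt (half_lt_self hη)
  filter_upwards [h] with N hN using hN y hy x hx hyx

lemma eventually_uniform_of_asymptotic_equicontinuous (hK : IsCompact K)
    (hlim : ∀ x ∈ K, Tendsto (u · x) l (𝓝 (v x)))
    (heq : ∀ η > 0, ∃ δ > 0, ∀ᶠ N in l, ∀ x ∈ K, ∀ y ∈ K, dist x y < δ →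
      |u N x - u N y| ≤ η) {η : ℝ} (hη : 0 < η) :
    ∀ᶠ N in l, ∀ x ∈ K, |u N x - v x| ≤ η := by
  obtain ⟨δ, hδ, h⟩ := heq (η / 3) (by positivity)
  obtain ⟨t, htK, htfin, hcov⟩ := hK.finite_cover_balls hδ
  have h1 : ∀ᶠ N in l, ∀ z ∈ t, |u N z - v z| ≤ η / 3 := by
    rw [eventually_all_finite htfin]
    intro z hz
    have := ((hlim z (htK hz)).sub_const (v z)).abs
    rw [sub_self, abs_zero] at this
    exact this.eventually_le_const (by positivity)
  filter_upwards [h, h1] with N hN hN1 x hx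
  obtain ⟨z, hz, hxz⟩ := mem_iUnion₂.1 (hcov hx)
  have h2 := hN x hx z (htK hz) hxz
  have h3 := hN1 z hz
  have h4 : |v x - v z| ≤ η / 3 := by
    refine abs_sub_le_of_tendsto (hlim x hx) (hlim z (htK hz)) ?_
    filter_upwards [h] with N hN using hN x hx z (htK hz) hxz
  rw [abs_le] at *
  constructor <;> linarith

end Compactness

section Approximation

open Filter Topology

variable {E : Type*} [NormedAddCommGroup E]

/-- Infimal convolution of `g` with the cone of slope `a`. -/
def infConv (a : ℝ) (g : E → ℝ) (x : E) : ℝ := ⨅ y, (g y + a * ‖x - y‖)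

variable {a C : ℝ} {g : E → ℝ}

lemma infConv_le (ha : 0 ≤ a) (hg : ∀ x, |g x| ≤ C) (x y : E) :
    infConv a g x ≤ g y + a * ‖x - y‖ := by
  refine ciInf_le ⟨-C, ?_⟩ y
  rintro _ ⟨z, rfl⟩
  have : 0 ≤ a * ‖x - z‖ := by positivity
  linarith [(abs_le.1 (hg z)).1]

lemma abs_infConv_le (ha : 0 ≤ a) (hg : ∀ x, |g x| ≤ C) (x : E) : |infConv a g x| ≤ C := by
  refine abs_le.2 ⟨le_ciInf fun y => ?_, ?_⟩
  · have : 0 ≤ a * ‖x - y‖ := by positivity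
    linarith [(abs_le.1 (hg y)).1]
  · simpa using (infConv_le ha hg x x).trans (by simpa using (abs_le.1 (hg x)).2)

lemma abs_infConv_sub_le (ha : 0 ≤ a) (hg : ∀ x, |g x| ≤ C) (x y : E) :
    |infConv a g x - infConv a g y| ≤ a * ‖x - y‖ := by
  have key : ∀ x y, infConv a g x - a * ‖x - y‖ ≤ infConv a g y := fun x y =>
    le_ciInf fun z => by
      have h1 := infConv_le ha hg x z
      have h2 : a * ‖x - z‖ ≤ a * (‖x - y‖ + ‖y - z‖) := by
        gcongr
        exact norm_sub_le_norm_sub_add_norm_sub x y z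
      linarith
  have h1 := key x y
  have h2 := key y x
  rw [norm_sub_rev] at h2
  rw [abs_le]
  constructor <;> linarith

lemma eventually_abs_infConv_sub_le [ProperSpace E] (hg : ∀ x, |g x| ≤ C) (hc : Continuous g)
    (R : ℝ) {η : ℝ} (hη : 0 < η) :
    ∀ᶠ N : ℕ in atTop, ∀ x : E, ‖x‖ ≤ R → |infConv N g x - g x| ≤ η := by
  have huc := (isCompact_closedBall (0 : E) (R + 1)).uniformContinuousOn_of_continuous
    hc.continuousOn
  obtain ⟨δ, hδ, hu⟩ := Metric.uniformContinuousOn_iff.1 huc η hη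
  have hδ' : 0 < min δ 1 := lt_min hδ one_pos
  filter_upwards [(tendsto_natCast_atTop_atTop (R := ℝ)).eventually_ge_atTop
    (2 * C / min δ 1)] with N hN x hx
  have hN' : 2 * C ≤ N * min δ 1 := by rwa [div_le_iff₀ hδ'] at hN
  have h0 : (0 : ℝ) ≤ N := N.cast_nonneg
  rw [abs_le]
  constructor
  · rw [neg_le_sub_iff_le_add]
    refine sub_le_iff_le_add.1 (le_ciInf fun y => ?_)
    rcases lt_or_ge ‖x - y‖ (min δ 1) with h1 | h1
    · have hy : ‖y‖ ≤ R + 1 := by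
        have h2 := norm_le_norm_add_norm_sub x y
        linarith [h1.trans_le (min_le_right δ 1)]
      have h2 := hu x (by simp; linarith) y (by simpa using hy)
        (by rw [dist_eq_norm]; exact h1.trans_le (min_le_left _ _))
      rw [Real.dist_eq, abs_lt] at h2
      have : 0 ≤ N * ‖x - y‖ := by positivity
      linarith
    · have h2 : N * min δ 1 ≤ N * ‖x - y‖ := by gcongr
      linarith [(abs_le.1 (hg x)).2, (abs_le.1 (hg y)).1]
  · have := infConv_le h0 hg x x
    simp only [sub_self, norm_zero, mul_zero, add_zero] at this
    linarith

/-- Bounded continuous maps into finite-dimensional spaces are locally uniform limits of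
uniformly bounded Lipschitz maps. -/
lemma exists_lipschitz_approx [ProperSpace E] {W : Type*} [NormedAddCommGroup W] [NormedSpace ℝ W]
    [FiniteDimensional ℝ W] {G : E → W} (hG : Continuous G) (hC : ∀ x, ‖G x‖ ≤ C) :
    ∃ (H : ℕ → E → W) (C' : ℝ) (L : ℕ → ℝ), (∀ N x, ‖H N x‖ ≤ C') ∧ (∀ N, 0 ≤ L N) ∧
      (∀ N x y, ‖H N x - H N y‖ ≤ L N * ‖x - y‖) ∧
      ∀ R, ∀ η > 0, ∀ᶠ N in atTop, ∀ x, ‖x‖ ≤ R → ‖H N x - G x‖ ≤ η := by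
  let v := Module.finBasis ℝ W
  let c : Fin (Module.finrank ℝ W) → W →L[ℝ] ℝ := fun i =>
    LinearMap.toContinuousLinearMap (v.coord i)
  have hcb : ∀ i x, |c i (G x)| ≤ ‖c i‖ * C := fun i x =>
    ((c i).le_opNorm (G x)).trans (by gcongr; exact hC x)
  have hrep : ∀ x, G x = ∑ i, c i (G x) • v i := fun x => (v.sum_repr (G x)).symm
  refine ⟨fun N x => ∑ i, infConv N (fun y => c i (G y)) x • v i,
    ∑ i, ‖c i‖ * C * ‖v i‖, fun N => ∑ i, N * ‖v i‖, ?_, ?_, ?_, ?_⟩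
  · intro N x
    refine norm_sum_le_of_le _ fun i _ => ?_
    rw [norm_smul]
    gcongr
    exact abs_infConv_le N.cast_nonneg (hcb i) x
  · intro N
    positivity
  · intro N x y
    rw [← Finset.sum_sub_distrib, Finset.sum_mul]
    refine norm_sum_le_of_le _ fun i _ => ?_
    rw [← sub_smul, norm_smul, mul_right_comm]
    gcongr
    exact abs_infConv_sub_le N.cast_nonneg (hcb i) x y
  · intro R η hη
    set q := ∑ i, ‖v i‖ with hq
    have hq0 : 0 ≤ q := by positivity
    have hev : ∀ᶠ N : ℕ in atTop, ∀ i, ∀ x, ‖x‖ ≤ R →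
        |infConv N (fun y => c i (G y)) x - c i (G x)| ≤ η / (q + 1) := by
      rw [eventually_all]
      exact fun i => eventually_abs_infConv_sub_le (hcb i) ((c i).continuous.comp hG) R
        (by positivity)
    filter_upwards [hev] with N hN x hx
    conv_lhs => rw [hrep x]
    rw [← Finset.sum_sub_distrib]
    calc _ ≤ ∑ i, η / (q + 1) * ‖v i‖ := by
          refine norm_sum_le_of_le _ fun i _ => ?_
          rw [← sub_smul, norm_smul]
          gcongr
          exact hN i x hx
      _ = η / (q + 1) * q := by rw [← Finset.mul_sum]
      _ ≤ η := by
          rw [div_mul_eq_mul_div, div_le_iff₀ (by positivity)]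
          nlinarith

end Approximation

section Equicontinuity

open Filter Topology ContinuousLinearMap

lemma exists_modulus_quadratic {E : Type*} [SeminormedAddCommGroup E] {f : E → ℝ} {C : ℝ}
    (hf : ∀ x, |f x| ≤ C) (huc : UniformContinuous f) {η : ℝ} (hη : 0 < η) :
    ∃ M, 0 ≤ M ∧ ∀ x y, f x - f y ≤ η + M * ‖x - y‖ ^ 2 := by
  obtain ⟨δ, hδ, h⟩ := Metric.uniformContinuous_iff.1 huc η hη
  have hC : 0 ≤ C := (abs_nonneg _).trans (hf 0)
  refine ⟨2 * C / δ ^ 2, by positivity, fun x y => ?_⟩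
  rcases lt_or_ge ‖x - y‖ δ with h1 | h1
  · have h2 : dist (f x) (f y) < η := h (by rwa [dist_eq_norm])
    have h3 : 0 ≤ 2 * C / δ ^ 2 * ‖x - y‖ ^ 2 := by positivity
    rw [Real.dist_eq] at h2
    linarith [le_abs_self (f x - f y)]
  · have h2 : 2 * C / δ ^ 2 * δ ^ 2 ≤ 2 * C / δ ^ 2 * ‖x - y‖ ^ 2 := by gcongr
    rw [div_mul_cancel₀ _ (by positivity)] at h2
    linarith [(abs_le.1 (hf x)).2, (abs_le.1 (hf y)).1]

variable {E F : Type*} [NormedAddCommGroup E] [InnerProductSpace ℝ E]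
  [NormedAddCommGroup F] [InnerProductSpace ℝ F]

lemma one_add_mul_pow_le_exp {c h t : ℝ} (hc : 0 ≤ c) (hh : 0 ≤ h) {k : ℕ} (hk : k * h ≤ t) :
    (1 + c * h) ^ k ≤ Real.exp (c * t) := by
  calc (1 + c * h) ^ k ≤ Real.exp (c * h) ^ k := by
        gcongr
        linarith [Real.add_one_le_exp (c * h)]
    _ = Real.exp (c * (k * h)) := by rw [← Real.exp_nat_mul]; ring_nf
    _ ≤ Real.exp (c * t) := by gcongr

variable {m : ℕ} {T C Cb Cs : ℝ} {h L : ℕ → ℝ} {b : ℕ → E → E} {S : ℕ → E → F →L[ℝ] E}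
  {S₀ : E → F →L[ℝ] E} {f : E → ℝ}

/-- Equicontinuity of the scheme in time, uniform in space. -/
lemma schemeIter_time_equicontinuous [Nonempty (OrthonormalBasis (Fin m) ℝ F)]
    (hm : 0 < m) (hh : ∀ N, 0 ≤ h N) (hh1 : ∀ N, h N ≤ 1)
    (hb : ∀ N x, ‖b N x‖ ≤ Cb) (hS : ∀ N x, ‖S N x‖ ≤ Cs)
    (hf : ∀ x, |f x| ≤ C) (huc : UniformContinuous f) {η : ℝ} (hη : 0 < η) :
    ∃ δ > 0, ∀ N, ∀ j k : ℕ, j * h N ≤ δ → ∀ x,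
      |schemeIter m (h N) (b N) (S N) f (j + k) x - schemeIter m (h N) (b N) (S N) f k x| ≤ η := by
  have hCb : 0 ≤ Cb := (norm_nonneg _).trans (hb 0 0)
  obtain ⟨M, hM, hmod⟩ := exists_modulus_quadratic hf huc (show 0 < η / 2 by positivity)
  set c := Cb + Cb ^ 2 + m * Cs ^ 2 with hc_def
  have hc : 0 ≤ c := by positivity
  have hlim : Tendsto (fun δ : ℝ => M * (Real.exp (c * δ) - 1)) (𝓝[>] 0) (𝓝 0) := by
    have : Continuous fun δ : ℝ => M * (Real.exp (c * δ) - 1) := by fun_prop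
    simpa using this.continuousWithinAt (s := Ioi 0) (x := 0) |>.tendsto
  obtain ⟨δ, hδη, hδ⟩ :=
    ((hlim.eventually (ge_mem_nhds (half_pos hη))).and self_mem_nhdsWithin).exists
  refine ⟨δ, hδ, fun N j k hj x => ?_⟩
  refine abs_schemeIter_add_sub_le hm hf (fun y => ?_) k x
  refine (abs_schemeIter_sub_init_le hm (hh N) (hh1 N) hM (hb N) (hS N) hf hmod j y).trans ?_
  have h1 : (1 + c * h N) ^ j ≤ Real.exp (c * δ) := one_add_mul_pow_le_exp hc (hh N) hj
  have h2 : M * ((1 + c * h N) ^ j - 1) ≤ M * (Real.exp (c * δ) - 1) := by gcongr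
  linarith

variable [FiniteDimensional ℝ E] [FiniteDimensional ℝ F]

lemma exists_unit_preimage {D : F →L[ℝ] E} {l : ℝ} (hl : 0 < l)
    (hD : ∀ e, l * ‖e‖ ≤ ‖adjoint D e‖) {e : E} (he : ‖e‖ = 1) :
    ∃ w : F, ∃ μ : ℝ, ‖w‖ = 1 ∧ l ^ 2 ≤ μ ^ 2 ∧ D w = μ • e := by
  have hinj : Function.Injective ((D ∘L adjoint D : E →L[ℝ] E) : E →ₗ[ℝ] E) := by
    refine (injective_iff_map_eq_zero _).2 fun v hv => ?_
    have h1 : ‖adjoint D v‖ ^ 2 = 0 := by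
      rw [← real_inner_self_eq_norm_sq, adjoint_inner_right]
      have : D (adjoint D v) = 0 := hv
      simp [this]
    have h2 := hD v
    rw [pow_eq_zero_iff two_ne_zero] at h1
    rw [h1] at h2
    exact norm_le_zero_iff.1 (by nlinarith [norm_nonneg v])
  obtain ⟨v, hv⟩ := LinearMap.surjective_of_injective hinj e
  have hv' : D (adjoint D v) = e := hv
  have hw0 : adjoint D v ≠ 0 := by
    intro h0
    rw [h0, map_zero] at hv'
    simp [← hv'] at he
  have hw : 0 < ‖adjoint D v‖ := norm_pos_iff.2 hw0
  have h1 : ‖adjoint D v‖ ^ 2 ≤ ‖v‖ := by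
    rw [← real_inner_self_eq_norm_sq, adjoint_inner_left, hv']
    simpa [he] using real_inner_le_norm v e
  have h2 : l * ‖adjoint D v‖ ≤ 1 := by
    have := hD v
    by_contra! h3
    nlinarith
  refine ⟨‖adjoint D v‖⁻¹ • adjoint D v, ‖adjoint D v‖⁻¹, ?_, ?_, ?_⟩
  · rw [norm_smul, norm_inv, norm_norm, inv_mul_cancel₀ hw.ne']
  · gcongr
    rwa [← one_div, le_div_iff₀ hw]
  · rw [map_smul, hv']

lemma exists_uniform_ellipticity {S : E → F →L[ℝ] E} (hS : Continuous S)
    (hpos : ∀ x e, e ≠ 0 → adjoint (S x) e ≠ 0) (R : ℝ) :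
    ∃ l > 0, ∀ x, ‖x‖ ≤ R → ∀ e, l * ‖e‖ ≤ ‖adjoint (S x) e‖ := by
  have hcpt := (isCompact_closedBall (0 : E) R).prod (isCompact_sphere (0 : E) 1)
  have hcont : Continuous fun q : E × E => ‖adjoint (S q.1) q.2‖ := by
    have : Continuous fun q : E × E => adjoint (S q.1) :=
      (LinearIsometryEquiv.continuous adjoint).comp (hS.comp continuous_fst)
    exact (this.clm_apply continuous_snd).norm
  obtain ⟨l, hl, h⟩ := hcpt.exists_forall_le' (a := 0) hcont.continuousOn fun q hq =>
    norm_pos_iff.2 (hpos _ _ fun h0 => by simp [h0] at hq)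
  refine ⟨l, hl, fun x hx e => ?_⟩
  rcases eq_or_ne e 0 with rfl | he
  · simp
  have he' : 0 < ‖e‖ := norm_pos_iff.2 he
  have h1 := h (x, ‖e‖⁻¹ • e) ⟨by simpa using hx, by simp [norm_smul, he'.ne']⟩
  simp only [map_smul, norm_smul, norm_inv, norm_norm] at h1
  rwa [← div_eq_inv_mul, le_div_iff₀ he'] at h1

lemma ellipticity_of_near {D D' : F →L[ℝ] E} {l : ℝ} (hD : ∀ e, l * ‖e‖ ≤ ‖adjoint D e‖)
    (hDD : ‖D' - D‖ ≤ l / 2) (e : E) : l / 2 * ‖e‖ ≤ ‖adjoint D' e‖ := by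
  have h1 : ‖adjoint D' e - adjoint D e‖ ≤ l / 2 * ‖e‖ := by
    rw [← sub_apply, ← map_sub]
    refine (le_opNorm _ _).trans ?_
    rw [LinearIsometryEquiv.norm_map]
    gcongr
  have h2 := norm_sub_norm_le (adjoint D e) (adjoint D e - adjoint D' e)
  rw [sub_sub_cancel, norm_sub_rev] at h2
  linarith [hD e]

/-- Spatial equicontinuity of the scheme, uniform in the number of steps up to time `T`. -/
lemma schemeIter_space_equicontinuous [Nonempty (OrthonormalBasis (Fin m) ℝ F)]
    (hm : 0 < m) (hh : ∀ N, 0 ≤ h N) (hh1 : ∀ N, h N ≤ 1)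
    (hL : ∀ N, 0 ≤ L N) (hbL : ∀ N x y, ‖b N x - b N y‖ ≤ L N * ‖x - y‖)
    (hSL : ∀ N x y, ‖S N x - S N y‖ ≤ L N * ‖x - y‖)
    (hb : ∀ N x, ‖b N x‖ ≤ Cb) (hS : ∀ N x, ‖S N x‖ ≤ Cs)
    (hf : ∀ x, |f x| ≤ C) (huc : UniformContinuous f)
    (hsmall : ∀ A, ∀ᶠ N in atTop,
      √(h N) * A ≤ Real.exp (-((2 * L N + L N ^ 2 + m * L N ^ 2) * T)))
    (hS₀ : Continuous S₀) (hpos : ∀ x e, e ≠ 0 → adjoint (S₀ x) e ≠ 0)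
    (hconv : ∀ R, ∀ η > 0, ∀ᶠ N in atTop, ∀ x, ‖x‖ ≤ R → ‖S N x - S₀ x‖ ≤ η)
    (r : ℝ) {η : ℝ} (hη : 0 < η) :
    ∃ δ > 0, ∀ᶠ N in atTop, ∀ k : ℕ, k * h N ≤ T → ∀ x y, ‖x‖ ≤ r → ‖y‖ ≤ r → ‖x - y‖ < δ →
      |schemeIter m (h N) (b N) (S N) f k x - schemeIter m (h N) (b N) (S N) f k y| ≤ η := by
  have hm' : (0 : ℝ) < m := by exact_mod_cast hm
  have hC : 0 ≤ C := (abs_nonneg _).trans (hf 0)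
  have hCb : 0 ≤ Cb := (norm_nonneg _).trans (hb 0 0)
  have hCs : 0 ≤ Cs := (norm_nonneg _).trans (hS 0 0)
  obtain ⟨M, hM, hmod⟩ := exists_modulus_quadratic hf huc (show 0 < η / 4 by positivity)
  set c := Cb + Cb ^ 2 + m * Cs ^ 2 with hc_def
  have hc : 0 ≤ c := by positivity
  set Q := 16 * C * Real.exp (c * T) * (1 + r ^ 2) / η with hQ
  have hQ0 : 0 ≤ Q := by positivity
  set R := Q + 1 with hR_def
  have hR : 0 < R := by positivity
  have hRQ : Q ≤ R ^ 2 := by nlinarith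
  obtain ⟨l, hl, hell⟩ := exists_uniform_ellipticity hS₀ hpos R
  set ε := √((l / 2) ^ 2 / (45 * m)) with hε_def
  have hε : 0 < ε := Real.sqrt_pos.2 (by positivity)
  have hε2 : 5 * m * (3 * ε) ^ 2 = (l / 2) ^ 2 := by
    rw [mul_pow, hε_def, Real.sq_sqrt (by positivity)]
    field_simp
    norm_num
  obtain ⟨d, hd, hunif⟩ := Metric.uniformContinuousOn_iff.1
    ((isCompact_closedBall (0 : E) R).uniformContinuousOn_of_continuous hS₀.continuousOn) ε hε
  set r₀ := min (d / 2) (min 1 ((l / 2) ^ 2 / (64 * Cb + 1))) with hr₀_def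
  have hr₀ : 0 < r₀ := by positivity
  set K := 1 + M + 2 * C / √r₀ with hK_def
  have hsr : 0 < √r₀ := Real.sqrt_pos.2 hr₀
  have hCr : 0 ≤ 2 * C / √r₀ := by positivity
  have hK : 0 < K := by positivity
  refine ⟨(η / (4 * K)) ^ 2, by positivity, ?_⟩
  filter_upwards [hconv R ε hε, hconv R (l / 2) (by positivity),
    hsmall (4 * Cb * (M + 1)), hsmall (√m * (40 * Cs) * (M + 1))] with N hN1 hN2 hN3 hN4
  set ex := (2 * L N + L N ^ 2 + m * L N ^ 2) * T with hex
  have hsq : h N ≤ √(h N) := by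
    refine Real.le_sqrt_of_sq_le ?_
    nlinarith [hh N, hh1 N]
  have key : ∀ k : ℕ, k * h N ≤ T → ∀ x y : E, ‖x‖ ≤ r → ‖y‖ ≤ r →
      ‖x - y‖ < (η / (4 * K)) ^ 2 →
      schemeIter m (h N) (b N) (S N) f k x - schemeIter m (h N) (b N) (S N) f k y ≤ η := by
    intro k hk x y hx hy hxy
    have main := schemeIter_sub_le_local (b := b N) (S := S N) (f := f) (h := h N) (R := R)
      (r₀ := r₀) (ρ := Real.exp (-ex) / (M + 1)) (l := (l / 2) ^ 2) (K := K) (T := T) hm (hh N)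
      (hh1 N) (hL N) hM (by positivity) (hbL N) (hSL N) (hb N) (hS N) hf hmod hR
      (fun z hz e he => exists_unit_preimage (by positivity)
        (fun e' => ellipticity_of_near (hell z hz) (hN2 z hz) e') he)
      (fun z w hz hw hzw => by
        have h1 : dist (S₀ z) (S₀ w) < ε := by
          refine hunif z (by simpa using hz) w (by simpa using hw) ?_
          rw [dist_eq_norm]
          have : r₀ ≤ d / 2 := min_le_left _ _
          linarith
        rw [dist_eq_norm] at h1
        have h2 : ‖S N z - S N w‖ ≤ 3 * ε := by
          have : S N z - S N w = (S N z - S₀ z) + (S₀ z - S₀ w) - (S N w - S₀ w) := by abel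
          rw [this]
          refine (norm_sub_le _ _).trans ?_
          linarith [norm_add_le (S N z - S₀ z) (S₀ z - S₀ w), hN1 z hz, hN1 w hw]
        rw [← hε2]
        gcongr)
      ((min_le_right _ _).trans (min_le_left _ _))
      (by
        have h1 : r₀ ≤ (l / 2) ^ 2 / (64 * Cb + 1) := (min_le_right _ _).trans (min_le_right _ _)
        rw [le_div_iff₀ (by positivity)] at h1
        nlinarith)
      (by linarith) (by linarith)
      (by
        have : 2 * C / √r₀ * √r₀ ≤ K * √r₀ := by gcongr; linarith
        rwa [div_mul_cancel₀ _ hsr.ne'] at this)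
      (by positivity)
      (by
        rw [← hex, mul_assoc, mul_div_assoc', ← Real.exp_add, add_neg_cancel, Real.exp_zero,
          mul_one_div, div_le_one (by positivity)]
        linarith)
      (by
        rw [le_div_iff₀ (by positivity)]
        refine le_trans ?_ hN3
        calc 4 * Cb * h N * (M + 1) = h N * (4 * Cb * (M + 1)) := by ring
          _ ≤ _ := by gcongr)
      (by
        rw [le_div_iff₀ (by positivity), Real.sqrt_mul (hh N)]
        refine le_trans (le_of_eq ?_) hN4
        ring)
      k hk x y
    have h1 : K * √‖x - y‖ ≤ η / 4 := by
      have : √‖x - y‖ ≤ η / (4 * K) := Real.sqrt_le_iff.2 ⟨by positivity, hxy.le⟩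
      calc K * √‖x - y‖ ≤ K * (η / (4 * K)) := by gcongr
        _ = η / 4 := by field_simp
    have h2 : (1 + c * h N) ^ k ≤ Real.exp (c * T) := one_add_mul_pow_le_exp hc (hh N) hk
    have h3 : 2 * C / R ^ 2 * (1 + c * h N) ^ k *
        ((1 + ‖x - 0‖ ^ 2) + (1 + ‖y - 0‖ ^ 2)) ≤ η / 4 := by
      rw [sub_zero, sub_zero]
      calc 2 * C / R ^ 2 * (1 + c * h N) ^ k * ((1 + ‖x‖ ^ 2) + (1 + ‖y‖ ^ 2))
          ≤ 2 * C / R ^ 2 * Real.exp (c * T) * ((1 + r ^ 2) + (1 + r ^ 2)) := by gcongr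
        _ = η / 4 * Q / R ^ 2 := by rw [hQ]; field_simp; ring
        _ ≤ η / 4 := by
          rw [div_le_iff₀ (by positivity)]
          gcongr
    linarith
  intro k hk x y hx hy hxy
  exact abs_le.2 ⟨by linarith [key k hk y x hy hx (by rwa [norm_sub_rev])], key k hk x y hx hy hxy⟩

end Equicontinuity

section Limit

open Filter Topology ContinuousLinearMap

section Normed

variable {E : Type*} [NormedAddCommGroup E]

lemma eventually_near_of_locally_uniform {W : Type*} [NormedAddCommGroup W] {l : Filter ℕ}
    {H : ℕ → E → W} {G : E → W} (hG : Continuous G)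
    (hconv : ∀ R, ∀ η > 0, ∀ᶠ N in l, ∀ x, ‖x‖ ≤ R → ‖H N x - G x‖ ≤ η) (x₀ : E) {ε : ℝ}
    (hε : 0 < ε) : ∃ δ > 0, ∀ᶠ N in l, ∀ y, ‖y - x₀‖ ≤ δ → ‖H N y - G x₀‖ ≤ ε := by
  obtain ⟨δ, hδ, hd⟩ := Metric.continuousAt_iff.1 hG.continuousAt (ε / 2) (half_pos hε)
  refine ⟨δ / 2, half_pos hδ, ?_⟩
  filter_upwards [hconv (‖x₀‖ + δ) (ε / 2) (half_pos hε)] with N hN y hy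
  have h1 := hN y (by linarith [norm_sub_norm_le y x₀])
  have h2 : dist (G y) (G x₀) < ε / 2 := hd (by rw [dist_eq_norm]; linarith)
  rw [dist_eq_norm] at h2
  linarith [norm_sub_le_norm_sub_add_norm_sub (H N y) (G y) (G x₀)]

lemma floor_div_mul_le {t h T : ℝ} (hh : 0 < h) (ht : t ∈ Icc 0 T) : ⌊t / h⌋₊ * h ≤ T := by
  have := Nat.floor_le (div_nonneg ht.1 hh.le)
  rw [le_div_iff₀ hh] at this
  exact this.trans ht.2

lemma floor_sub_floor_mul_le {s t h : ℝ} (hh : 0 < h) (hs : 0 ≤ s) (hst : s ≤ t) :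
    ((⌊t / h⌋₊ - ⌊s / h⌋₊ : ℕ) : ℝ) * h ≤ t - s + h := by
  have hle : ⌊s / h⌋₊ ≤ ⌊t / h⌋₊ := Nat.floor_le_floor (by gcongr)
  have h1 := Nat.floor_le (div_nonneg (hs.trans hst) hh.le)
  have h2 := Nat.lt_floor_add_one (s / h)
  rw [le_div_iff₀ hh] at h1
  rw [div_lt_iff₀ hh] at h2
  rw [Nat.cast_sub hle]
  linarith

/-- Space and time equicontinuity of discrete evolutions combine. -/
lemma equicontinuous_interpolation {W : ℕ → ℕ → E → ℝ} {h : ℕ → ℝ} {T r : ℝ} (hpos : ∀ N, 0 < h N)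
    (hlim : Tendsto h atTop (𝓝 0))
    (hspace : ∀ η > 0, ∃ δ > 0, ∀ᶠ N in atTop, ∀ k : ℕ, k * h N ≤ T → ∀ x y, ‖x‖ ≤ r → ‖y‖ ≤ r →
      ‖x - y‖ < δ → |W N k x - W N k y| ≤ η)
    (htime : ∀ η > 0, ∃ δ > 0, ∀ N, ∀ j k : ℕ, j * h N ≤ δ → ∀ x,
      |W N (j + k) x - W N k x| ≤ η) (η : ℝ) (hη : 0 < η) :
    ∃ δ > 0, ∀ᶠ N in atTop, ∀ q ∈ Metric.closedBall (0 : E) r ×ˢ Icc (0 : ℝ) T,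
      ∀ q' ∈ Metric.closedBall (0 : E) r ×ˢ Icc (0 : ℝ) T, dist q q' < δ →
      |W N ⌊q.2 / h N⌋₊ q.1 - W N ⌊q'.2 / h N⌋₊ q'.1| ≤ η := by
  obtain ⟨δ₁, hδ₁, h1⟩ := hspace (η / 2) (half_pos hη)
  obtain ⟨δ₂, hδ₂, h2⟩ := htime (η / 2) (half_pos hη)
  refine ⟨min δ₁ (δ₂ / 2), by positivity, ?_⟩
  filter_upwards [h1, hlim.eventually (ge_mem_nhds (half_pos hδ₂))] with N hN hhN
  have key : ∀ q ∈ Metric.closedBall (0 : E) r ×ˢ Icc (0 : ℝ) T,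
      ∀ q' ∈ Metric.closedBall (0 : E) r ×ˢ Icc (0 : ℝ) T, dist q q' < min δ₁ (δ₂ / 2) →
      q'.2 ≤ q.2 → |W N ⌊q.2 / h N⌋₊ q.1 - W N ⌊q'.2 / h N⌋₊ q'.1| ≤ η := by
    rintro ⟨x, t⟩ ⟨hx, ht⟩ ⟨y, s⟩ ⟨hy, hs⟩ hd hst
    simp only [Prod.dist_eq, max_lt_iff, lt_min_iff] at hd hst hx hy ht hs ⊢
    have hj := floor_sub_floor_mul_le (hpos N) hs.1 hst
    have hle : ⌊s / h N⌋₊ ≤ ⌊t / h N⌋₊ :=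
      Nat.floor_le_floor (div_le_div_of_nonneg_right hst (hpos N).le)
    have hts : t - s < δ₂ / 2 := (le_abs_self _).trans_lt hd.2.2
    have e1 := h2 N (⌊t / h N⌋₊ - ⌊s / h N⌋₊) ⌊s / h N⌋₊ (by linarith) x
    rw [Nat.sub_add_cancel hle] at e1
    have e2 := hN ⌊s / h N⌋₊ (floor_div_mul_le (hpos N) hs) x y (by simpa using hx)
      (by simpa using hy) (by simpa [dist_eq_norm] using hd.1.1)
    linarith [abs_sub_le (W N ⌊t / h N⌋₊ x) (W N ⌊s / h N⌋₊ x) (W N ⌊s / h N⌋₊ y)]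
  intro q hq q' hq' hd
  rcases le_total q'.2 q.2 with h3 | h3
  · exact key q hq q' hq' hd h3
  · rw [abs_sub_comm]
    exact key q' hq' q hq (by rwa [dist_comm]) h3

end Normed

variable {E F : Type*} [NormedAddCommGroup E] [InnerProductSpace ℝ E]
  [NormedAddCommGroup F] [InnerProductSpace ℝ F]

/-- The function `u` is never touched strictly from above, in the past, by a quadratic test
function which is a strict supersolution at the contact point. -/
def NotStrictlyTouched (m : ℕ) (T : ℝ) (b : E → E) (S : E → F →L[ℝ] E) (u : E → ℝ → ℝ) : Prop :=
  ∀ (x₀ : E), ∀ t₀ ∈ Ioo 0 T, ∀ (A : E →L[ℝ] E) (p : E) (a δ η κ : ℝ), 0 < δ → 0 < η → 0 < κ →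
    (∀ y s, ‖y - x₀‖ ≤ δ → t₀ - δ ≤ s → s ≤ t₀ →
      u y s ≤ u x₀ t₀ + a * (s - t₀) + ⟪p, y - x₀⟫ + 2⁻¹ * ⟪y - x₀, A (y - x₀)⟫
        - η * ((t₀ - s) + ‖y - x₀‖ ^ 2)) →
    ¬∀ B : OrthonormalBasis (Fin m) ℝ F,
      2⁻¹ * ∑ i, ⟪S x₀ (B i), A (S x₀ (B i))⟫ + ⟪p, b x₀⟫ + κ ≤ a

variable {m : ℕ} {T C Cb Cs : ℝ} {h : ℝ} {b : E → E} {S : E → F →L[ℝ] E} {f : E → ℝ}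
  [Nonempty (OrthonormalBasis (Fin m) ℝ F)]

lemma schemeIter_succ_le {k : ℕ} {y : E} {ψ : E → ℝ} {c : ℝ}
    (hψ : ∀ v : F, ‖v‖ = 1 → schemeIter m h b S f k (stepPt m h b S y v) ≤ ψ (stepPt m h b S y v))
    (hc : ∀ B : OrthonormalBasis (Fin m) ℝ F, frameAvg B (fun v => ψ (stepPt m h b S y v)) ≤ c) :
    schemeIter m h b S f (k + 1) y ≤ c :=
  schemeStep_le fun B => (frameAvg_mono (B := B)
    (G := fun v => schemeIter m h b S f k (stepPt m h b S y v))
    (H := fun v => ψ (stepPt m h b S y v)) (fun i => hψ _ (by simp))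
    (fun i => hψ _ (by simp))).trans (hc B)

lemma neg_schemeIter_succ_le (hm : 0 < m) (hf : ∀ x, |f x| ≤ C) {k : ℕ} {y : E} {ψ : E → ℝ} {c : ℝ}
    (hψ : ∀ v : F, ‖v‖ = 1 →
      -schemeIter m h b S f k (stepPt m h b S y v) ≤ ψ (stepPt m h b S y v))
    (hc : ∀ B : OrthonormalBasis (Fin m) ℝ F, frameAvg B (fun v => ψ (stepPt m h b S y v)) ≤ c) :
    -schemeIter m h b S f (k + 1) y ≤ c := by
  obtain ⟨B⟩ := ‹Nonempty (OrthonormalBasis (Fin m) ℝ F)›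
  have : Nonempty (OrthonormalBasis (Fin m) ℝ F) := ⟨B⟩
  have h1 := frameAvg_le_schemeStep (h := h) (b := b) (S := S) hm
    (abs_schemeIter_le (h := h) (b := b) (S := S) hm hf k) y B
  have h2 := frameAvg_mono (B := B) (G := fun v => -schemeIter m h b S f k (stepPt m h b S y v))
    (H := fun v => ψ (stepPt m h b S y v)) (fun i => hψ _ (by simp)) (fun i => hψ _ (by simp))
  rw [frameAvg_neg] at h2
  exact (by linarith [hc B] : -schemeStep m h b S (schemeIter m h b S f k) y ≤ c)

variable [FiniteDimensional ℝ E] [FiniteDimensional ℝ F]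

/-- The limit of the scheme for nondegenerate bounded continuous coefficients. -/
theorem exists_scheme_limit (hm : 0 < m) (hT : 0 < T) (hbc : Continuous b) (hSc : Continuous S)
    (hb : ∀ x, ‖b x‖ ≤ Cb) (hS : ∀ x, ‖S x‖ ≤ Cs) (hpos : ∀ x e, e ≠ 0 → adjoint (S x) e ≠ 0)
    (hf : ∀ x, |f x| ≤ C) (huc : UniformContinuous f) :
    ∃ u : E → ℝ → ℝ, (∀ x t, |u x t| ≤ C) ∧
      ContinuousOn (Function.uncurry u) (univ ×ˢ Icc 0 T) ∧ (∀ x, u x 0 = f x) ∧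
      NotStrictlyTouched m T b S u ∧ NotStrictlyTouched m T b S fun x t => -u x t := by
  obtain ⟨bN, Cb', Lb, hbN, hLb, hbL, hbconv⟩ := exists_lipschitz_approx hbc hb
  obtain ⟨SN, Cs', Ls, hSN, hLs, hSL, hSconv⟩ := exists_lipschitz_approx hSc hS
  set L : ℕ → ℝ := fun N => Lb N + Ls N with hL_def
  have hL : ∀ N, 0 ≤ L N := fun N => add_nonneg (hLb N) (hLs N)
  set e : ℕ → ℝ := fun N => Real.exp (-((2 * L N + L N ^ 2 + m * L N ^ 2) * T)) with he_def
  have he0 : ∀ N, 0 < e N := fun N => Real.exp_pos _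
  have he1 : ∀ N, e N ≤ 1 := fun N => Real.exp_le_one_iff.2 (by
    have := hL N
    have : 0 ≤ (2 * L N + L N ^ 2 + m * L N ^ 2) * T := by positivity
    linarith)
  set h : ℕ → ℝ := fun N => (e N / (N + 1)) ^ 2 with hh_def
  have hsq0 : ∀ N : ℕ, 0 < e N / ((N : ℝ) + 1) := fun N => by have := he0 N; positivity
  have hsq1 : ∀ N : ℕ, e N / ((N : ℝ) + 1) ≤ 1 := fun N => by
    rw [div_le_one (by positivity)]
    linarith [he1 N, (Nat.cast_nonneg N : (0 : ℝ) ≤ N)]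
  have hh0 : ∀ N, 0 < h N := fun N => pow_pos (hsq0 N) 2
  have hh1 : ∀ N, h N ≤ 1 := fun N => pow_le_one₀ (hsq0 N).le (hsq1 N)
  have hlim : Tendsto h atTop (𝓝 0) := by
    refine squeeze_zero (fun N => (hh0 N).le) (fun N => ?_)
      tendsto_one_div_add_atTop_nhds_zero_nat
    calc h N ≤ e N / ((N : ℝ) + 1) := pow_le_of_le_one (hsq0 N).le (hsq1 N) two_ne_zero
      _ ≤ 1 / ((N : ℝ) + 1) := by gcongr; exact he1 N
  have hsmall : ∀ A, ∀ᶠ N in atTop, √(h N) * A ≤ e N := by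
    intro A
    filter_upwards [eventually_ge_atTop ⌈A⌉₊] with N hN
    have hA : A ≤ N := (Nat.le_ceil A).trans (by exact_mod_cast hN)
    rw [hh_def, Real.sqrt_sq (hsq0 N).le, div_mul_eq_mul_div, div_le_iff₀ (by positivity)]
    have := he0 N
    gcongr
    linarith
  set W : ℕ → ℕ → E → ℝ := fun N => schemeIter m (h N) (bN N) (SN N) f with hW_def
  have hWC : ∀ N k x, |W N k x| ≤ C := fun N k x => abs_schemeIter_le hm hf k x
  have hequi := fun r => equicontinuous_interpolation (W := W) (r := r) (T := T) hh0 hlim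
    (fun η hη => schemeIter_space_equicontinuous hm (fun N => (hh0 N).le) hh1 hL
      (fun N x y => (hbL N x y).trans (by gcongr; exact le_add_of_nonneg_right (hLs N)))
      (fun N x y => (hSL N x y).trans (by gcongr; exact le_add_of_nonneg_left (hLb N)))
      hbN hSN hf huc hsmall hSc hpos hSconv r hη)
    (fun η hη => schemeIter_time_equicontinuous hm (fun N => (hh0 N).le) hh1 hbN hSN hf huc hη)
  let l : Ultrafilter ℕ := Ultrafilter.of atTop
  have hl : (l : Filter ℕ) ≤ atTop := Ultrafilter.of_le _
  obtain ⟨v, hv⟩ := exists_ultralimit l (u := fun N (q : E × ℝ) => W N ⌊q.2 / h N⌋₊ q.1)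
    fun N q => hWC N _ q.1
  have hequil : ∀ r, ∀ η > 0, ∃ δ > 0, ∀ᶠ N in (l : Filter ℕ),
      ∀ q ∈ Metric.closedBall (0 : E) r ×ˢ Icc (0 : ℝ) T,
      ∀ q' ∈ Metric.closedBall (0 : E) r ×ˢ Icc (0 : ℝ) T, dist q q' < δ →
      |W N ⌊q.2 / h N⌋₊ q.1 - W N ⌊q'.2 / h N⌋₊ q'.1| ≤ η := fun r η hη => by
    obtain ⟨δ, hδ, h1⟩ := hequi r η hη
    exact ⟨δ, hδ, hl h1⟩
  have hconv : ∀ r, ∀ η > 0, ∀ᶠ N in (l : Filter ℕ), ∀ y, ‖y‖ ≤ r → ∀ t ∈ Icc 0 T,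
      |W N ⌊t / h N⌋₊ y - v (y, t)| ≤ η := by
    intro r η hη
    filter_upwards [eventually_uniform_of_asymptotic_equicontinuous
      ((isCompact_closedBall (0 : E) r).prod isCompact_Icc) (fun q _ => (hv q).2) (hequil r) hη]
      with N hN y hy t ht
    exact hN (y, t) ⟨by simpa using hy, ht⟩
  have hcoef : ∀ x₀, ∀ ε > 0, ∃ δ > 0, ∀ᶠ N in (l : Filter ℕ), ∀ y, ‖y - x₀‖ ≤ δ →
      ‖bN N y - b x₀‖ ≤ ε ∧ ‖SN N y - S x₀‖ ≤ ε := by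
    intro x₀ ε hε
    obtain ⟨δ₁, hδ₁, h1⟩ := eventually_near_of_locally_uniform hbc hbconv x₀ hε
    obtain ⟨δ₂, hδ₂, h2⟩ := eventually_near_of_locally_uniform hSc hSconv x₀ hε
    refine ⟨min δ₁ δ₂, lt_min hδ₁ hδ₂, ?_⟩
    filter_upwards [hl h1, hl h2] with N hN1 hN2 y hy
    exact ⟨hN1 y (hy.trans (min_le_left _ _)), hN2 y (hy.trans (min_le_right _ _))⟩
  refine ⟨fun x t => v (x, t), fun x t => (hv _).1, ?_, fun x => ?_, ?_, ?_⟩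
  · rintro ⟨x, t⟩ ⟨-, ht⟩
    have h1 := continuousOn_of_asymptotic_equicontinuous (fun q _ => (hv q).2)
      (hequil (‖x‖ + 1)) (x, t) ⟨by simp, ht⟩
    refine h1.mono_of_mem_nhdsWithin ?_
    rw [nhdsWithin_prod_eq]
    refine prod_mem_prod ?_ self_mem_nhdsWithin
    rw [nhdsWithin_univ]
    refine mem_of_superset (Metric.closedBall_mem_nhds x one_pos) fun y hy => ?_
    rw [Metric.mem_closedBall, dist_eq_norm] at hy
    rw [mem_closedBall_zero_iff]
    linarith [norm_sub_norm_le y x]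
  · refine tendsto_nhds_unique (hv (x, 0)).2 ?_
    simp [hW_def, schemeIter]
  · intro x₀ t₀ ht₀ A p a δ η κ hδ hη hκ htouch hgap
    exact scheme_limit_not_touched (l := l) (W := W) (u := fun x t => v (x, t)) hm hh0
      (hlim.mono_left hl) (Cs := max Cs Cs') hbN (fun N x => (hSN N x).trans (le_max_right _ _))
      (fun N k y ψ c => schemeIter_succ_le) ht₀ hconv ((hS x₀).trans (le_max_left _ _))
      (hcoef x₀) hδ hη hκ htouch hgap
  · intro x₀ t₀ ht₀ A p a δ η κ hδ hη hκ htouch hgap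
    refine scheme_limit_not_touched (l := l) (W := fun N k x => -W N k x)
      (u := fun x t => -v (x, t)) hm hh0
      (hlim.mono_left hl) (Cs := max Cs Cs') hbN (fun N x => (hSN N x).trans (le_max_right _ _))
      (fun N k y ψ c => neg_schemeIter_succ_le hm hf) ht₀ ?_ ((hS x₀).trans (le_max_left _ _))
      (hcoef x₀) hδ hη hκ htouch hgap
    intro r ε hε
    filter_upwards [hconv r ε hε] with N hN y hy t ht
    rw [neg_sub_neg, abs_sub_comm]
    exact hN y hy t ht

end Limit

section MatrixCLM

open ContinuousLinearMap

variable {n m : ℕ}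

/-- The continuous linear map between Euclidean spaces given by a matrix. -/
def matrixCLM : Matrix (Fin n) (Fin m) ℝ →ₗ[ℝ] Evec m →L[ℝ] Evec n :=
  LinearMap.toContinuousLinearMap.toLinearMap ∘ₗ Matrix.toEuclideanLin.toLinearMap

lemma matrixCLM_apply (M : Matrix (Fin n) (Fin m) ℝ) (v : Evec m) :
    matrixCLM M v = Matrix.toEuclideanLin M v := rfl

lemma matrixCLM_apply_coord (M : Matrix (Fin n) (Fin m) ℝ) (v : Evec m) (i : Fin n) :
    matrixCLM M v i = ∑ j, M i j * v j := rfl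

lemma quadForm_eq_inner (X : Matrix (Fin n) (Fin n) ℝ) (v : Evec n) :
    quadForm X v = ⟪v, matrixCLM X v⟫ := by
  simp only [quadForm, PiLp.inner_apply, matrixCLM_apply_coord, RCLike.inner_apply, conj_trivial,
    Finset.sum_mul]
  exact Finset.sum_congr rfl fun i _ => Finset.sum_congr rfl fun j _ => by ring

lemma inner_matrixCLM_transpose (M : Matrix (Fin n) (Fin m) ℝ) (v : Evec m) (w : Evec n) :
    ⟪v, matrixCLM Mᵀ w⟫ = ⟪matrixCLM M v, w⟫ := by
  simp only [PiLp.inner_apply, matrixCLM_apply_coord, RCLike.inner_apply, conj_trivial,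
    Finset.sum_mul, Finset.mul_sum, Matrix.transpose_apply]
  rw [Finset.sum_comm]
  exact Finset.sum_congr rfl fun i _ => Finset.sum_congr rfl fun j _ => by ring

lemma matrixCLM_mul {k : ℕ} (M : Matrix (Fin n) (Fin m) ℝ) (M' : Matrix (Fin m) (Fin k) ℝ)
    (v : Evec k) : matrixCLM (M * M') v = matrixCLM M (matrixCLM M' v) := by
  ext i
  simp only [matrixCLM_apply_coord, Matrix.mul_apply, Finset.sum_mul, Finset.mul_sum]
  rw [Finset.sum_comm]
  exact Finset.sum_congr rfl fun i _ => Finset.sum_congr rfl fun j _ => by ring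

lemma norm_matrixCLM_le (M : Matrix (Fin n) (Fin m) ℝ) : ‖matrixCLM M‖ ≤ frobNorm M := by
  refine opNorm_le_bound _ (Real.sqrt_nonneg _) fun v => ?_
  rw [frobNorm, EuclideanSpace.norm_eq, EuclideanSpace.norm_eq, ← Real.sqrt_mul (by positivity),
    Finset.sum_mul]
  refine Real.sqrt_le_sqrt (Finset.sum_le_sum fun i _ => ?_)
  simp only [Real.norm_eq_abs, sq_abs, matrixCLM_apply_coord]
  exact Finset.sum_mul_sq_le_sq_mul_sq _ _ _

lemma continuous_matrixCLM_comp {X : Type*} [TopologicalSpace X]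
    {σ : X → Matrix (Fin n) (Fin m) ℝ} (hσ : ∀ i j, Continuous fun x => σ x i j) :
    Continuous fun x => matrixCLM (σ x) :=
  (LinearMap.continuous_of_finiteDimensional matrixCLM).comp
    (continuous_matrix fun i j => hσ i j)

lemma adjoint_matrixCLM_ne_zero {M : Matrix (Fin n) (Fin m) ℝ} (hM : (M * Mᵀ).PosDef) {e : Evec n}
    (he : e ≠ 0) : adjoint (matrixCLM M) e ≠ 0 := by
  intro h0
  have h1 : ⟪e, matrixCLM (M * Mᵀ) e⟫ = 0 := by
    rw [matrixCLM_mul, ← adjoint_inner_left, h0, inner_zero_left]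
  have h2 := hM.dotProduct_mulVec_pos (x := e.ofLp) (by simpa using he)
  rw [← quadForm_eq_inner] at h1
  simp only [quadForm] at h1
  simp only [dotProduct, Matrix.mulVec, star_trivial, Finset.mul_sum, ← mul_assoc] at h2
  exact h2.ne' h1

lemma trace_mul_transpose_mul (M : Matrix (Fin n) (Fin m) ℝ) (X : Matrix (Fin n) (Fin n) ℝ)
    (B : OrthonormalBasis (Fin m) ℝ (Evec m)) :
    Matrix.trace (M * Mᵀ * X) =
      ∑ i, ⟪matrixCLM M (B i), matrixCLM X (matrixCLM M (B i))⟫ := by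
  have h1 := LinearMap.trace_eq_sum_inner (Matrix.toEuclideanLin (Mᵀ * X * M)) B
  rw [Matrix.mul_assoc, Matrix.trace_mul_comm, ← Matrix.trace_toLin_eq (Mᵀ * X * M)
    (PiLp.basisFun 2 ℝ (Fin m)), ← Matrix.toLpLin_eq_toLin, h1]
  refine Finset.sum_congr rfl fun i _ => ?_
  rw [← matrixCLM_apply, Matrix.mul_assoc, matrixCLM_mul, matrixCLM_mul,
    inner_matrixCLM_transpose]

lemma opL_eq (b : Evec n → Evec n) (σ : Evec n → Matrix (Fin n) (Fin m) ℝ)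
    (X : Matrix (Fin n) (Fin n) ℝ) (p x : Evec n) (B : OrthonormalBasis (Fin m) ℝ (Evec m)) :
    opL b σ X p x = 2⁻¹ * ∑ i, ⟪matrixCLM (σ x) (B i), matrixCLM X (matrixCLM (σ x) (B i))⟫ +
      ⟪p, b x⟫ := by
  rw [opL, trace_mul_transpose_mul _ _ B, real_inner_comm, one_div]

lemma le_opL_of_inSuperJet {T : ℝ} {b : Evec n → Evec n} {σ : Evec n → Matrix (Fin n) (Fin m) ℝ}
    {u : Evec n → ℝ → ℝ} (hu : NotStrictlyTouched m T b (fun x => matrixCLM (σ x)) u) {x : Evec n}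
    {t : ℝ} (ht : t ∈ Ioo 0 T) {a : ℝ} {p : Evec n} {X : Matrix (Fin n) (Fin n) ℝ}
    (hjet : InSuperJet T univ u x t a p X) : a ≤ opL b σ X p x := by
  by_contra! hlt
  set g := a - opL b σ X p x with hg_def
  have hg : 0 < g := sub_pos.2 hlt
  set D := matrixCLM (σ x) with hD
  set Q := m * ‖D‖ ^ 2 with hQ
  have hQ0 : 0 ≤ Q := by positivity
  set η := g / (4 * (Q + 1)) with hη_def
  have hη : 0 < η := by positivity
  have hηQ : 4 * η * (Q + 1) = g := by rw [hη_def]; field_simp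
  obtain ⟨δ, hδ, hjet⟩ := hjet η hη
  have ht0 : 0 < t := ht.1
  refine hu x t ht (matrixCLM X + (4 * η) • ContinuousLinearMap.id ℝ (Evec n)) p (a - 2 * η)
    (min (δ / 3) (t / 2)) η (g / 2) (by positivity) hη (half_pos hg) ?_ ?_
  · intro y s hy hs hst
    have h1 := hy.trans (min_le_left _ _)
    have h2 := min_le_left (δ / 3) (t / 2)
    have h3 := min_le_right (δ / 3) (t / 2)
    have habs : |s - t| = t - s := by rw [abs_sub_comm, abs_of_nonneg (by linarith)]
    have h4 := hjet y (mem_univ _) s ⟨by linarith, hst.trans_lt ht.2⟩ (by rw [habs]; linarith)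
    rw [habs, quadForm_eq_inner] at h4
    simp only [add_apply, smul_apply, id_apply, inner_add_right, inner_smul_right,
      real_inner_self_eq_norm_sq]
    linarith
  · intro B
    have h1 : ∑ i, ‖D (B i)‖ ^ 2 ≤ Q := by
      calc ∑ i, ‖D (B i)‖ ^ 2 ≤ ∑ _i : Fin m, ‖D‖ ^ 2 :=
            Finset.sum_le_sum fun i _ => by
              gcongr
              simpa using D.le_opNorm (B i)
        _ = Q := by simp [hQ]
    have h2 : 4 * η * ∑ i, ‖D (B i)‖ ^ 2 ≤ 4 * η * Q := by gcongr
    have h3 := opL_eq b σ X p x B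
    simp only [add_apply, smul_apply, id_apply, inner_add_right, inner_smul_right,
      real_inner_self_eq_norm_sq, Finset.sum_add_distrib, ← Finset.mul_sum]
    linarith

lemma opL_neg (b : Evec n → Evec n) (σ : Evec n → Matrix (Fin n) (Fin m) ℝ)
    (X : Matrix (Fin n) (Fin n) ℝ) (p x : Evec n) : opL b σ (-X) (-p) x = -opL b σ X p x := by
  simp only [opL, Matrix.mul_neg, Matrix.trace_neg, inner_neg_right]
  ring

/-- Existence when the noise has positive dimension and `σ x` is onto for every `x`. -/
theorem exists_viscosity_solution_of_pos (hm : 0 < m) {T : ℝ} (hT : 0 < T)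
    {b : Evec n → Evec n} {σ : Evec n → Matrix (Fin n) (Fin m) ℝ}
    (hb_cont : Continuous b) (hσ_cont : ∀ i j, Continuous fun x => σ x i j)
    (hb_bdd : ∃ C, ∀ x, ‖b x‖ ≤ C) (hσ_bdd : ∃ C, ∀ x, frobNorm (σ x) ≤ C)
    (hpos : ∀ x e, e ≠ 0 → adjoint (matrixCLM (σ x)) e ≠ 0)
    {f : Evec n → ℝ} (hf_bdd : ∃ C, ∀ x, |f x| ≤ C) (hf_uc : UniformContinuous f) :
    ∃ u : Evec n → ℝ → ℝ,
      (∃ C, ∀ x t, 0 ≤ t → t < T → |u x t| ≤ C) ∧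
      ContinuousOn (Function.uncurry u) (Set.univ ×ˢ Set.Ico 0 T) ∧
      SubsolutionPropOn b σ T Set.univ u ∧
      SupersolutionPropOn b σ T Set.univ u ∧
      ∀ x, u x 0 = f x := by
  obtain ⟨Cb, hCb⟩ := hb_bdd
  obtain ⟨Cs, hCs⟩ := hσ_bdd
  obtain ⟨C, hC⟩ := hf_bdd
  have : Nonempty (OrthonormalBasis (Fin m) ℝ (Evec m)) := ⟨EuclideanSpace.basisFun (Fin m) ℝ⟩
  obtain ⟨u, huC, hcont, hinit, hsub, hsup⟩ := exists_scheme_limit (m := m) hm hT hb_cont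
    (continuous_matrixCLM_comp hσ_cont) hCb (fun x => (norm_matrixCLM_le _).trans (hCs x)) hpos
    hC hf_uc
  refine ⟨u, ⟨C, fun x t _ _ => huC x t⟩, hcont.mono (prod_mono_right Ico_subset_Icc_self),
    fun x _ t ht a p X _ hjet => sub_nonpos.2 (le_opL_of_inSuperJet hsub ht hjet),
    fun x _ t ht a p X _ hjet => ?_, hinit⟩
  have h1 := le_opL_of_inSuperJet hsup ht hjet
  rw [opL_neg] at h1
  linarith

end MatrixCLM

/-- existence of a bounded continuous viscosity solution for bounded continuous
coefficients with everywhere positive definite diffusion matrix. -/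
theorem existence_nondegenerate {n m : ℕ} (T : ℝ) (hT : 0 < T)
    (bt : Evec n → Evec n) (σt : Evec n → Matrix (Fin n) (Fin m) ℝ)
    (hb_cont : Continuous bt) (hσ_cont : ∀ i j, Continuous fun x => σt x i j)
    (hb_bdd : ∃ C, ∀ x, ‖bt x‖ ≤ C) (hσ_bdd : ∃ C, ∀ x, frobNorm (σt x) ≤ C)
    (hpos : ∀ x, (σt x * (σt x)ᵀ).PosDef)
    (f : Evec n → ℝ) (hf_bdd : ∃ C, ∀ x, |f x| ≤ C) (hf_uc : UniformContinuous f) :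
    ∃ u : Evec n → ℝ → ℝ,
      (∃ C, ∀ x t, 0 ≤ t → t < T → |u x t| ≤ C) ∧
      ContinuousOn (Function.uncurry u) (Set.univ ×ˢ Set.Ico 0 T) ∧
      SubsolutionPropOn bt σt T Set.univ u ∧
      SupersolutionPropOn bt σt T Set.univ u ∧
      ∀ x, u x 0 = f x := by
  have hpos' : ∀ x e, e ≠ 0 → ContinuousLinearMap.adjoint (matrixCLM (σt x)) e ≠ 0 :=
    fun x e he => adjoint_matrixCLM_ne_zero (hpos x) he
  rcases Nat.eq_zero_or_pos m with rfl | hm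
  · obtain rfl : n = 0 := by
      by_contra hn
      obtain ⟨i⟩ : Nonempty (Fin n) := ⟨⟨0, Nat.pos_of_ne_zero hn⟩⟩
      exact hpos' 0 (EuclideanSpace.single i 1) (by simp) (Subsingleton.elim _ _)
    -- A diffusion matrix of size `0 × 0` is insensitive to the dimension of the noise.
    have hop : opL bt σt = opL (m := 1) bt fun _ => 0 := by
      ext X p x
      simp [opL, Matrix.trace]
    have main := exists_viscosity_solution_of_pos (m := 1) (σ := fun _ => 0) one_pos hT hb_cont
      (fun _ _ => continuous_const) hb_bdd ⟨_, fun _ => le_rfl⟩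
      (fun _ e he => absurd (Subsingleton.elim e 0) he) hf_bdd hf_uc
    simpa only [SubsolutionPropOn, SupersolutionPropOn, hop] using main
  · exact exists_viscosity_solution_of_pos hm hT hb_cont hσ_cont hb_bdd hσ_bdd hpos' hf_bdd hf_uc

end
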